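/- Let V be a Banach 𝕆-bimodule, T a power-associative bounded right para-linear operator on V, J ∈ 𝕊 and s ∈ ℂ_J with |s| > ‖T‖. Then for every integer m ≥ 1 and every z ∈ ℂ_J(V), (R_s − T)^{−m}(z) = ∑_{n≥0} C(m+n−1, m−1) · Tⁿ(z·s^{−m−n}), where the series converges in norm and C(·,·) denotes binomial coefficients. In particular, (R_s − T)^{−1} is ℂ_J-extendable power associative. -/

import Mathlib

noncomputable section

open scoped BigOperators

/-- Octonions, realized via the Cayley–Dickson doubling of the quaternions. -/
@[ext]
structure Oct : Type where
  a : Quaternion ℝ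
  b : Quaternion ℝ

namespace Oct

instance : Zero Oct := ⟨⟨0, 0⟩⟩
instance : Add Oct := ⟨fun x y => ⟨x.a + y.a, x.b + y.b⟩⟩
instance : Neg Oct := ⟨fun x => ⟨-x.a, -x.b⟩⟩
instance : Sub Oct := ⟨fun x y => ⟨x.a - y.a, x.b - y.b⟩⟩
instance : SMul ℕ Oct := ⟨fun n x => ⟨n • x.a, n • x.b⟩⟩
instance : SMul ℤ Oct := ⟨fun n x => ⟨n • x.a, n • x.b⟩⟩
instance : SMul ℝ Oct := ⟨fun r x => ⟨r • x.a, r • x.b⟩⟩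

def toLp (x : Oct) : WithLp 2 (Quaternion ℝ × Quaternion ℝ) :=
  (WithLp.equiv 2 (Quaternion ℝ × Quaternion ℝ)).symm (x.a, x.b)

lemma toLp_injective : Function.Injective toLp := by
  rintro ⟨xa, xb⟩ ⟨ya, yb⟩ h
  have ha : xa = ya :=
    congrArg (fun z => (WithLp.equiv 2 (Quaternion ℝ × Quaternion ℝ) z).1) h
  have hb : xb = yb :=
    congrArg (fun z => (WithLp.equiv 2 (Quaternion ℝ × Quaternion ℝ) z).2) h
  subst ha; subst hb; rfl

instance : AddCommGroup Oct :=
  toLp_injective.addCommGroup toLp rfl (fun _ _ => rfl) (fun _ => rfl) (fun _ _ => rfl)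
    (fun _ _ => rfl) (fun _ _ => rfl)

def toLpHom : Oct →+ WithLp 2 (Quaternion ℝ × Quaternion ℝ) where
  toFun := toLp
  map_zero' := rfl
  map_add' _ _ := rfl

instance : Module ℝ Oct := toLp_injective.module ℝ toLpHom fun _ _ => rfl

instance : NormedAddCommGroup Oct :=
  NormedAddCommGroup.induced Oct (WithLp 2 (Quaternion ℝ × Quaternion ℝ)) toLpHom toLp_injective

instance : NormedSpace ℝ Oct := ⟨fun r x => norm_smul_le r (toLp x)⟩

def toProdLin : Oct →ₗ[ℝ] Quaternion ℝ × Quaternion ℝ where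
  toFun x := (x.a, x.b)
  map_add' _ _ := rfl
  map_smul' _ _ := rfl

lemma toProdLin_injective : Function.Injective toProdLin := by
  rintro ⟨xa, xb⟩ ⟨ya, yb⟩ h
  have ha : xa = ya := congrArg Prod.fst h
  have hb : xb = yb := congrArg Prod.snd h
  subst ha; subst hb; rfl

instance : FiniteDimensional ℝ Oct :=
  FiniteDimensional.of_injective toProdLin toProdLin_injective

instance : CompleteSpace Oct := FiniteDimensional.complete ℝ Oct

instance : One Oct := ⟨⟨1, 0⟩⟩

instance : Mul Oct :=
  ⟨fun x y => ⟨x.a * y.a - star y.b * x.b, y.b * x.a + x.b * star y.a⟩⟩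

/-- Octonionic conjugation. -/
def conj (x : Oct) : Oct := ⟨star x.a, -x.b⟩

/-- The real part of an octonion. -/
def re (x : Oct) : ℝ := x.a.re

/-- Powers of an octonion (association chosen on the left factor). -/
def opow (s : Oct) : ℕ → Oct
  | 0 => 1
  | n + 1 => s * opow s n

/-- The inverse of a nonzero octonion. -/
def oinv (s : Oct) : Oct := (‖s‖ ^ 2)⁻¹ • conj s

/-- `invPow s n` is the octonion `s ^ (-1 - n)`. -/
def invPow (s : Oct) (n : ℕ) : Oct := opow (oinv s) (n + 1)

def eNat : ℕ → Oct
  | 0 => ⟨1, 0⟩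
  | 1 => ⟨⟨0, 1, 0, 0⟩, 0⟩
  | 2 => ⟨⟨0, 0, 1, 0⟩, 0⟩
  | 3 => ⟨⟨0, 0, 0, 1⟩, 0⟩
  | 4 => ⟨0, 1⟩
  | 5 => ⟨0, ⟨0, 1, 0, 0⟩⟩
  | 6 => ⟨0, ⟨0, 0, 1, 0⟩⟩
  | 7 => ⟨0, ⟨0, 0, 0, 1⟩⟩
  | _ => 0

/-- The standard basis `e_0 = 1, e_1, …, e_7` of the octonions. -/
def e (i : Fin 8) : Oct := eNat i.val

/-- The six-dimensional sphere `𝕊` of imaginary units of `𝕆`. -/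
def unitSphere : Set Oct := {J | J * J = -1}

/-- The slice `ℂ_J = ℝ ⊕ ℝJ` of the octonions. -/
def sliceC (J : Oct) : Set Oct := {s | ∃ x y : ℝ, s = x • (1 : Oct) + y • J}

/-- The embedding of `ℂ` onto the slice `ℂ_J`, `x + y i ↦ x + y J`. -/
def toSlice (J : Oct) (z : ℂ) : Oct := z.re • (1 : Oct) + z.im • J

end Oct

open Oct

/-- A (normed/Banach) `𝕆`-bimodule: a real normed space with continuous real-bilinear left and
right octonionic multiplications satisfying the alternativity relations
`[p,q,x] = [q,x,p] = [x,p,q] = -[q,p,x]` and the norm identities `‖px‖ = |p|‖x‖ = ‖xp‖`. -/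
class OctBimodule (V : Type*) [NormedAddCommGroup V] [NormedSpace ℝ V] : Type _ where
  lm : Oct →ₗ[ℝ] V →L[ℝ] V
  rm : Oct →ₗ[ℝ] V →L[ℝ] V
  lm_one : ∀ x : V, lm 1 x = x
  rm_one : ∀ x : V, rm 1 x = x
  /-- `[p,q,x] = [q,x,p]` -/
  assoc_cyc₁ : ∀ (p q : Oct) (x : V),
    lm (p * q) x - lm p (lm q x) = rm p (lm q x) - lm q (rm p x)
  /-- `[p,q,x] = [x,p,q]` -/
  assoc_cyc₂ : ∀ (p q : Oct) (x : V),
    lm (p * q) x - lm p (lm q x) = rm q (rm p x) - rm (p * q) x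
  /-- `[p,q,x] = -[q,p,x]` -/
  assoc_alt : ∀ (p q : Oct) (x : V),
    lm (p * q) x - lm p (lm q x) = -(lm (q * p) x - lm q (lm p x))
  norm_lm : ∀ (p : Oct) (x : V), ‖lm p x‖ = ‖p‖ * ‖x‖
  norm_rm : ∀ (p : Oct) (x : V), ‖rm p x‖ = ‖p‖ * ‖x‖

section OctMod

variable {V : Type*} [NormedAddCommGroup V] [NormedSpace ℝ V] [OctBimodule V]

/-- Left multiplication `x ↦ p x` as a bounded real-linear operator. -/
def lmo (p : Oct) : V →L[ℝ] V := OctBimodule.lm p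

/-- Right multiplication `R_p : x ↦ x p` as a bounded real-linear operator. -/
def rmo (p : Oct) : V →L[ℝ] V := OctBimodule.rm p

variable (V)

/-- The real-part projection `Re x = (5/12) x - (1/12) ∑_{i=1}^7 e_i x e_i` of an
`𝕆`-bimodule. -/
def reO : V →L[ℝ] V :=
  (5 / 12 : ℝ) • ContinuousLinearMap.id ℝ V -
    (1 / 12 : ℝ) • ∑ i : Fin 7, (rmo (e i.succ)).comp (lmo (e i.succ))

/-- The real part `Re V` of an `𝕆`-bimodule, i.e. the set of associative central elements. -/
def ReSet : Set V :=
  {m | (∀ p q : Oct, lmo (p * q) m = lmo p (lmo q m)) ∧ ∀ p : Oct, lmo p m = rmo p m}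

/-- The slice `ℂ_J(V) = Re V ⊕ J · Re V` of an `𝕆`-bimodule. -/
def CJV (J : Oct) : Set V :=
  {x | ∃ u ∈ ReSet V, ∃ w ∈ ReSet V, x = u + lmo J w}

/-- The slice projection `π_J(x) = Re x + J Re (J̄ x)`. -/
def piJ (J : Oct) : V →L[ℝ] V :=
  reO V + (lmo J).comp ((reO V).comp (lmo (Oct.conj J)))

variable {V}

/-- The second right associator `B_p(T, x) = T(x) p - T(x p)` of an operator. -/
def Bop (p : Oct) (T : V →L[ℝ] V) : V →L[ℝ] V := (rmo p).comp T - T.comp (rmo p)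

/-- A bounded real-linear operator is right (octonionic) para-linear if `Re B_p(T,x) = 0`. -/
def IsRightPara (T : V →L[ℝ] V) : Prop := ∀ (p : Oct) (x : V), reO V (Bop p T x) = 0

/-- The left octonionic scalar multiplication `(p ⊙ T)(x) = p T(x) + B_p(T,x)` on operators. -/
def odotL (p : Oct) (T : V →L[ℝ] V) : V →L[ℝ] V := (lmo p).comp T + Bop p T

/-- The right octonionic scalar multiplication `(T ⊙ p)(x) = T(p x) - B_p(T,x)` on operators. -/
def odotR (T : V →L[ℝ] V) (p : Oct) : V →L[ℝ] V := T.comp (lmo p) - Bop p T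

/-- The lifting map, `(lif F)(x) = ∑_i F(x ē_i) e_i`. -/
def lifO (F : V →L[ℝ] V) : V →L[ℝ] V :=
  ∑ i : Fin 8, (rmo (e i)).comp (F.comp (rmo (Oct.conj (e i))))

/-- The extension map, `(ext G)(∑ x_i e_i) = ∑ G(x_i) e_i`, where `x_i = Re (x ē_i)`. -/
def extO (G : V →L[ℝ] V) : V →L[ℝ] V :=
  ∑ i : Fin 8, (rmo (e i)).comp (G.comp ((reO V).comp (rmo (Oct.conj (e i)))))

/-- The left regular power `T^{n⊚} = lif (Re ∘ Tⁿ)`. -/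
def rpowL (T : V →L[ℝ] V) (n : ℕ) : V →L[ℝ] V := lifO ((reO V).comp (T ^ n))

/-- The right regular power `T^{⊚n} = ext (Tⁿ|_{Re V})`. -/
def rpowR (T : V →L[ℝ] V) (n : ℕ) : V →L[ℝ] V := extO (T ^ n)

/-- The regular composition `f ⊚ g = lif (Re ∘ f ∘ g)`. -/
def rcomp (f g : V →L[ℝ] V) : V →L[ℝ] V := lifO ((reO V).comp (f.comp g))

/-- The composition associator `[f,g,x]_⊚ = (f ⊚ g)(x) - f(g(x))`. -/
def compAssoc (f g : V →L[ℝ] V) (x : V) : V := rcomp f g x - f (g x)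

/-- The right regular inverse `T^{⊚-} = ext (T⁻¹|_{Re V})` of an invertible operator. -/
def rinvR (T : V →L[ℝ] V) : V →L[ℝ] V := extO (Ring.inverse T)

/-- The left regular inverse `T^{-⊚} = lif (Re ∘ T⁻¹)` of an invertible operator. -/
def rinvL (T : V →L[ℝ] V) : V →L[ℝ] V := lifO ((reO V).comp (Ring.inverse T))

/-- An operator is power-associative if all of its (composition) powers are right
para-linear. -/
def IsPowerAssoc (T : V →L[ℝ] V) : Prop := ∀ n : ℕ, IsRightPara (T ^ n)

/-- A bounded operator is octonionic linear if `T(xp) = T(x)p` for all `p`. -/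
def IsOctLinear (T : V →L[ℝ] V) : Prop := ∀ (p : Oct) (x : V), T (rmo p x) = rmo p (T x)

/-- `S` is `ℂ_J`-extendable power associative: `Sⁿ(v s) = Sⁿ(v) s` for `v ∈ Re V`,
`s ∈ ℂ_J`, `n ≥ 1`. -/
def CJExtPA (J : Oct) (S : V →L[ℝ] V) : Prop :=
  ∀ n : ℕ, 1 ≤ n → ∀ v ∈ ReSet V, ∀ s ∈ sliceC J, (S ^ n) (rmo s v) = rmo s ((S ^ n) v)

/-- `S` is `ℂ_J`-liftable power associative: `Re (Sⁿ(v s)) = Re (Sⁿ(v) s)` for all `v ∈ V`,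
`s ∈ ℂ_J`, `n ≥ 1`. -/
def CJLiftPA (J : Oct) (S : V →L[ℝ] V) : Prop :=
  ∀ n : ℕ, 1 ≤ n → ∀ (v : V), ∀ s ∈ sliceC J,
    reO V ((S ^ n) (rmo s v)) = reO V (rmo s ((S ^ n) v))

/-- The pull-back slice-resolvent set `ρ*_J(T)`. -/
def pbResSlice (T : V →L[ℝ] V) (J : Oct) : Set Oct :=
  {s | s ∈ sliceC J ∧ IsUnit ((rmo s : V →L[ℝ] V) - T) ∧
    CJExtPA J (Ring.inverse ((rmo s : V →L[ℝ] V) - T))}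

/-- The pull-back resolvent set `ρ*(T)`. -/
def pbRes (T : V →L[ℝ] V) : Set Oct := ⋃ J ∈ unitSphere, pbResSlice T J

/-- The pull-back spectrum `σ*(T) = 𝕆 ∖ ρ*(T)`. -/
def pbSpec (T : V →L[ℝ] V) : Set Oct := Set.univ \ pbRes T

/-- The push-forward slice-resolvent set `ρ_{*J}(T)`. -/
def pfResSlice (T : V →L[ℝ] V) (J : Oct) : Set Oct :=
  {s | s ∈ sliceC J ∧ IsUnit ((rmo s : V →L[ℝ] V) - T) ∧
    CJLiftPA J (Ring.inverse ((rmo s : V →L[ℝ] V) - T))}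

/-- The push-forward resolvent set `ρ_*(T)`. -/
def pfRes (T : V →L[ℝ] V) : Set Oct := ⋃ J ∈ unitSphere, pfResSlice T J

/-- The push-forward spectrum `σ_*(T) = 𝕆 ∖ ρ_*(T)`. -/
def pfSpec (T : V →L[ℝ] V) : Set Oct := Set.univ \ pfRes T

/-- The real-part projection of the `𝕆`-bimodule `𝓑_RO(V)` of bounded right para-linear
operators, given by `Re A = (5/12) A - (1/12) ∑_{i=1}^7 (e_i ⊙ A) ⊙ e_i`. -/
def reOpB (A : V →L[ℝ] V) : V →L[ℝ] V :=
  (5 / 12 : ℝ) • A - (1 / 12 : ℝ) • ∑ i : Fin 7, odotR (odotL (e i.succ) A) (e i.succ)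

end OctMod

/-- A set `U ⊆ 𝕆` is slice-open if `U ∩ ℂ_J` is open in `ℂ_J` for every `J ∈ 𝕊`. -/
def SliceOpen (U : Set Oct) : Prop :=
  ∀ J ∈ unitSphere, IsOpen (Oct.toSlice J ⁻¹' U)

/-- A parametrization of the boundary `∂(U ∩ ℂ_J)` by finitely many continuously
differentiable, positively oriented Jordan curves (positivity of the orientation is encoded
through the winding numbers). -/
structure SliceContour (J : Oct) (U : Set Oct) where
  n : ℕ
  γ : Fin n → ℝ → ℂ
  smooth : ∀ i, ContDiff ℝ 1 (γ i)
  closed : ∀ i, γ i 0 = γ i 1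
  jordan : ∀ i, Set.InjOn (γ i) (Set.Ico (0 : ℝ) 1)
  image_eq : (⋃ i, γ i '' Set.Icc (0 : ℝ) 1) = frontier (Oct.toSlice J ⁻¹' U)
  winding_inside : ∀ z : ℂ, Oct.toSlice J z ∈ U →
    (∑ i, ∫ t in (0 : ℝ)..1, deriv (γ i) t / (γ i t - z)) = 2 * (Real.pi : ℂ) * Complex.I
  winding_outside : ∀ z : ℂ, Oct.toSlice J z ∉ closure U →
    (∑ i, ∫ t in (0 : ℝ)..1, deriv (γ i) t / (γ i t - z)) = 0

/-- The integral `∫_{∂(U ∩ ℂ_J)} Φ(s, ds)` along a slice contour: the integrand gets the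
point of the curve and its derivative (both in the coordinates of the slice). -/
def contourSum {J : Oct} {U : Set Oct} (Γ : SliceContour J U) {E : Type*}
    [NormedAddCommGroup E] [NormedSpace ℝ E] (Φ : ℂ → ℂ → E) : E :=
  ∑ i, ∫ t in (0 : ℝ)..1, Φ (Γ.γ i t) (deriv (Γ.γ i) t)

/-- An axially symmetric slice domain (s-domain) in `𝕆`. -/
structure IsAdmissibleDomain (U : Set Oct) : Prop where
  isOpen : IsOpen U
  isConnected : IsConnected U
  real_nonempty : (U ∩ {s : Oct | ∃ r : ℝ, s = r • (1 : Oct)}).Nonempty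
  axially : ∀ (z : ℂ), ∀ I ∈ unitSphere, ∀ J ∈ unitSphere,
    Oct.toSlice I z ∈ U → Oct.toSlice J z ∈ U
  slice_conn : ∀ J ∈ unitSphere, IsConnected (Oct.toSlice J ⁻¹' U)

section Adm

variable {V : Type*} [NormedAddCommGroup V] [NormedSpace ℝ V] [OctBimodule V]

/-- A `T`-left-admissible domain: an axially symmetric s-domain containing the pull-back
spectrum `σ*(T)`.  (The regularity of its slice boundaries is witnessed by the slice
contours used in the integrals.) -/
def LeftAdmissible (T : V →L[ℝ] V) (U : Set Oct) : Prop :=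
  IsAdmissibleDomain U ∧ pbSpec T ⊆ U

/-- A `T`-right-admissible domain: an axially symmetric s-domain containing the push-forward
spectrum `σ_*(T)`. -/
def RightAdmissible (T : V →L[ℝ] V) (U : Set Oct) : Prop :=
  IsAdmissibleDomain U ∧ pfSpec T ⊆ U

end Adm

/-- The axially symmetric set `Ω_D ⊆ 𝕆` induced by a conjugation-invariant set `D ⊆ ℂ`. -/
def OmegaD (D : Set ℂ) : Set Oct := ⋃ J ∈ unitSphere, Oct.toSlice J '' D

/-- `F` is the stem of a slice preserving slice regular function on `Ω_D`: it is holomorphic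
on the open conjugation-invariant set `D` and intertwines complex conjugation. -/
structure IsStem (D : Set ℂ) (F : ℂ → ℂ) : Prop where
  isOpen : IsOpen D
  conj_mem : ∀ z ∈ D, (starRingEnd ℂ) z ∈ D
  holo : DifferentiableOn ℂ F D
  conj_comm : ∀ z ∈ D, F ((starRingEnd ℂ) z) = (starRingEnd ℂ) (F z)

section FC

variable {V : Type*} [NormedAddCommGroup V] [NormedSpace ℝ V] [OctBimodule V]

/-- The slice integral `(1/2π) ∫_{∂(U∩ℂ_J)} (R_s - T)^{⊚-} ⊙ (ds_J f(s))` defining the left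
slice regular functional calculus of a slice preserving function with stem `F`. -/
def leftFC (T : V →L[ℝ] V) (J : Oct) {U : Set Oct} (Γ : SliceContour J U)
    (F : ℂ → ℂ) : V →L[ℝ] V :=
  (2 * Real.pi)⁻¹ • contourSum Γ fun z dz =>
    odotR (rinvR ((rmo (Oct.toSlice J z) : V →L[ℝ] V) - T))
      ((-(Oct.toSlice J dz) * J) * Oct.toSlice J (F z))

/-- The slice integral `(1/2π) ∫_{∂(U∩ℂ_J)} (f(s) ds_J) ⊙ (R_s - T)^{-⊚}` defining the right
slice regular functional calculus of a slice preserving function with stem `F`. -/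
def rightFC (T : V →L[ℝ] V) (J : Oct) {U : Set Oct} (Γ : SliceContour J U)
    (F : ℂ → ℂ) : V →L[ℝ] V :=
  (2 * Real.pi)⁻¹ • contourSum Γ fun z dz =>
    odotL (Oct.toSlice J (F z) * (-(Oct.toSlice J dz) * J))
      (rinvL ((rmo (Oct.toSlice J z) : V →L[ℝ] V) - T))

end FC

/-- The family of stems of the components, relative to `J = ∑ c_i e_i`, of a function of the
form `f₀ + f₁ • J` with `f₀, f₁` slice preserving with stems `F₀, F₁`. -/
def stemFamily (c : Fin 8 → ℝ) (F₀ F₁ : ℂ → ℂ) : Fin 8 → ℂ → ℂ :=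
  fun i z => if i = 0 then F₀ z else (c i : ℂ) * F₁ z

namespace Oct

/-- Left multiplication by an octonion, as a real-linear map. -/
def lmulLin (q : Oct) : Oct →ₗ[ℝ] Oct where
  toFun x := q * x
  map_add' x y := by
    refine Oct.ext ?_ ?_
    · show q.a * (x.a + y.a) - star (x.b + y.b) * q.b =
        (q.a * x.a - star x.b * q.b) + (q.a * y.a - star y.b * q.b)
      rw [mul_add, star_add, add_mul]; abel
    · show (x.b + y.b) * q.a + q.b * star (x.a + y.a) =
        (x.b * q.a + q.b * star x.a) + (y.b * q.a + q.b * star y.a)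
      rw [add_mul, star_add, mul_add]; abel
  map_smul' r x := by
    refine Oct.ext ?_ ?_
    · show q.a * (r • x.a) - star (r • x.b) * q.b = r • (q.a * x.a - star x.b * q.b)
      rw [mul_smul_comm, Quaternion.star_smul, smul_mul_assoc, smul_sub]
    · show (r • x.b) * q.a + q.b * star (r • x.a) = r • (x.b * q.a + q.b * star x.a)
      rw [smul_mul_assoc, Quaternion.star_smul, mul_smul_comm, smul_add]

/-- Left multiplication `L_q : x ↦ q x` as a bounded real-linear operator on `𝕆`. -/
def Lq (q : Oct) : Oct →L[ℝ] Oct := (lmulLin q).toContinuousLinearMap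

/-- The two-sphere `[q] = {Re q + |Im q| J : J ∈ 𝕊}` associated with an octonion `q`. -/
def qSphere (q : Oct) : Set Oct :=
  {s | ∃ J ∈ unitSphere, s = Oct.re q • (1 : Oct) + ‖q - Oct.re q • (1 : Oct)‖ • J}

end Oct


/-- A nonassociative ring is alternative if its associator is an alternating function. -/
structure IsAlternativeRing (A : Type*) [NonUnitalNonAssocRing A] : Prop where
  left : ∀ a b : A, associator a a b = 0
  right : ∀ a b : A, associator a b b = 0

namespace IsAlternativeRing

section Nonunital

variable {A : Type*} [NonUnitalNonAssocRing A]

lemma swap₁₂ (h : IsAlternativeRing A) (a b c : A) : associator a b c = -associator b a c := by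
  have h₀ := h.left (a + b) c
  have h₁ := h.left a c
  have h₂ := h.left b c
  simp only [associator, add_mul, mul_add] at *
  grind

lemma swap₂₃ (h : IsAlternativeRing A) (a b c : A) : associator a b c = -associator a c b := by
  have h₀ := h.right a (b + c)
  have h₁ := h.right a b
  have h₂ := h.right a c
  simp only [associator, add_mul, mul_add] at *
  grind

lemma swap₁₃ (h : IsAlternativeRing A) (a b c : A) : associator a b c = -associator c b a := by
  rw [h.swap₁₂, h.swap₂₃, h.swap₁₂, neg_neg]

lemma flexible (h : IsAlternativeRing A) (a b : A) : associator a b a = 0 := by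
  rw [h.swap₁₂, h.right, neg_zero]

lemma cycle (h : IsAlternativeRing A) (a b c : A) : associator a b c = associator c a b := by
  rw [h.swap₂₃, h.swap₁₂, neg_neg]

/-- The Kleinfeld function of an alternative ring is skew in its first and third arguments. -/
lemma kleinfeld_swap (h : IsAlternativeRing A) (a b c d : A) :
    associator (a * b) c d - b * associator a c d - associator b c d * a +
      (associator (c * b) a d - b * associator c a d - associator b a d * c) = 0 := by
  have t₁ := associator_cocycle a b c d
  have t₂ := associator_cocycle a c b d
  have t₃ := associator_cocycle b c d a
  have t₄ := associator_cocycle b d a c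
  simp only [h.swap₁₂ a (b * c) d, h.cycle a b (c * d), h.swap₁₂ c b d, h.swap₁₂ a (c * b) d,
    h.cycle a c (b * d), h.swap₂₃ a c b, h.cycle c d a, h.swap₂₃ (b * c) d a, ← h.cycle (c * d) a b,
    h.cycle b c (d * a), ← h.cycle a c d, h.swap₁₂ b (d * a) c, h.cycle b d (a * c),
    h.cycle b d a, h.swap₁₂ c a d, h.swap₁₂ b a d, mul_neg, neg_mul] at *
  grind

lemma associator_mul_left_self (h : IsAlternativeRing A) (a c d : A) :
    associator (a * d) c a = associator d c a * a := by
  have t₁ := associator_cocycle a a c d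
  have t₂ := associator_cocycle a a d c
  have t₃ := associator_cocycle a c d a
  have t₄ := associator_cocycle a d a c
  simp only [h.swap₁₂ a (a * c) d, h.left a (c * d), h.left a c, h.swap₂₃ a d c,
    h.swap₂₃ (a * a) d c, h.swap₁₂ a (a * d) c, h.left a (d * c), h.left a d, h.cycle c d a,
    h.swap₂₃ (a * c) d a, h.flexible a (c * d), h.cycle a c (d * a), ← h.cycle a c d,
    h.swap₁₂ a (d * a) c, h.cycle a d (a * c), h.flexible a d, h.swap₂₃ (a * d) c a,
    h.swap₁₃ d c a, mul_neg, neg_mul, zero_mul] at *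
  grind

lemma associator_mul_right_self (h : IsAlternativeRing A) (a c d : A) :
    associator (d * a) c a = a * associator d c a := by
  have t₁ := associator_cocycle a a c d
  have t₂ := associator_cocycle a a d c
  have t₃ := associator_cocycle a d a c
  simp only [h.swap₁₂ a (a * c) d, h.left a (c * d), h.left a c, h.swap₂₃ a d c,
    h.swap₂₃ (a * a) d c, h.swap₁₂ a (a * d) c, h.left a (d * c), h.left a d, ← h.cycle a c d,
    h.swap₁₂ a (d * a) c, h.cycle a d (a * c), h.flexible a d, h.swap₂₃ (d * a) c a, h.swap₁₃ d c a,
    mul_neg, zero_mul] at *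
  grind

lemma associator_sq (h : IsAlternativeRing A) (a c d : A) :
    associator (a * a) c d = a * associator a c d + associator a c d * a := by
  have t₁ := associator_cocycle a a c d
  have t₂ := associator_cocycle a a d c
  have t₃ := associator_cocycle a c d a
  have t₄ := associator_cocycle a d a c
  simp only [h.swap₁₂ a (a * c) d, h.left a (c * d), h.left a c, h.swap₂₃ a d c,
    h.swap₂₃ (a * a) d c, h.swap₁₂ a (a * d) c, h.left a (d * c), h.left a d, h.cycle c d a,
    h.swap₂₃ (a * c) d a, h.flexible a (c * d), h.cycle a c (d * a), ← h.cycle a c d,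
    h.swap₁₂ a (d * a) c, h.cycle a d (a * c), h.flexible a d, mul_neg, zero_mul] at *
  grind

/-- If `a` and `b` associate with `z`, so does their product, by the more precise formula. -/
lemma associator_mul_of_associates (h : IsAlternativeRing A) {a z : A}
    (ha : ∀ p, associator a p z = 0) (b c : A) :
    associator (a * b) c z = associator b c z * a := by
  have k := h.kleinfeld_swap a b c z
  rw [h.swap₁₂ (c * b) a z, h.swap₁₂ c a z, h.swap₁₂ b a z] at k
  simp only [ha, mul_zero, zero_mul, neg_zero, sub_zero, add_zero] at k
  exact sub_eq_zero.mp k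

/-- An element of the nucleus commutes with all associators. -/
lemma commute_associator (h : IsAlternativeRing A) {n : A} (hn : ∀ p q, associator n p q = 0)
    (x y w : A) : n * associator x y w = associator x y w * n := by
  have t := associator_cocycle n x y w
  rw [h.associator_mul_of_associates (fun p => hn p w)] at t
  simp only [hn, zero_mul, add_zero, sub_zero] at t
  exact sub_eq_zero.mp t

/-- Anticommuting with `a`, `b` and `ab` forces opposite associativity. -/
lemma mul_mul_of_anticommute (h : IsAlternativeRing A) {a b x : A} (ha : a * x = -(x * a))
    (hb : b * x = -(x * b)) (hab : a * b * x = -(x * (a * b))) :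
    a * (b * x) = -(a * b * x) ∧ x * a * b = a * b * x := by
  have h₁ : associator a b x = a * b * x - a * (b * x) := rfl
  have h₂ : associator a x b = -(x * a * b) + a * (b * x) := by
    rw [associator, ha, hb]; simp [sub_eq_add_neg]
  have h₃ : associator x a b = x * a * b + a * b * x := by
    rw [associator, hab, sub_eq_add_neg]
  rw [h.swap₂₃] at h₂
  rw [← h.cycle] at h₃
  constructor <;> grind

lemma mul_anticommute (h : IsAlternativeRing A) {a b x : A} (ha : a * x = -(x * a))
    (hb : b * x = -(x * b))
    (hab : a * b * x = -(x * (a * b))) (h' : a * b = -(b * a)) :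
    a * (b * x) = -(b * x * a) := by
  have hba : b * a * x = -(x * (b * a)) := by
    rw [show b * a = -(a * b) by rw [h', neg_neg]]
    simp [hab]
  rw [(h.mul_mul_of_anticommute ha hb hab).1, hb, neg_mul,
    (h.mul_mul_of_anticommute hb ha hba).2, h', neg_mul]

/-- The anticommutator of `x` with `b` has no scalar part if that with `a` vanishes. -/
lemma scalar_part_eq_zero (h : IsAlternativeRing A) [IsAddTorsionFree A] {a b c x : A}
    (hab : a * b = -(b * a))
    (hc : ∀ p q, associator p q c = 0) (hac : a * c = c * a)
    (ha : a * x = -(x * a)) (hb : b * x + x * b = b * c + b * c) : a * b * c = 0 := by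
  have hba : b * a = -(a * b) := by rw [hab, neg_neg]
  have e₁ : a * (b * c) = a * b * c := (sub_eq_zero.mp (hc a b)).symm
  have e₂ : b * c * a = -(a * b * c) := by
    have : associator b c a = 0 := by rw [h.cycle, hc]
    rw [sub_eq_zero.mp this, ← hac, ← sub_eq_zero.mp (hc b a), hba, neg_mul]
  have hb₁ : x * b = b * c + b * c - b * x := by rw [← hb]; abel
  have hb₂ : b * x = b * c + b * c - x * b := by rw [← hb]; abel
  have h₁ : associator a b x = a * b * x - a * (b * x) := rfl
  have h₂ : associator a x b = -(x * a * b) - (a * b * c + a * b * c - a * (b * x)) := by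
    rw [associator, ha, hb₁, mul_sub, mul_add, e₁, neg_mul]
  have h₃ : associator x a b = x * a * b - x * (a * b) := rfl
  have h₄ : associator b a x = -(a * b * x) - b * (a * x) := by rw [associator, hba, neg_mul]
  have h₅ : associator b x a = -(a * b * c) + -(a * b * c) - x * b * a + b * (a * x) := by
    rw [associator, hb₂, sub_mul, add_mul, e₂, ha, mul_neg]; abel
  have h₆ : associator x b a = x * b * a + x * (a * b) := by
    rw [associator, hba, mul_neg]; abel
  rw [h.swap₂₃ a x b] at h₂
  rw [← h.cycle] at h₃
  rw [h.swap₁₂] at h₄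
  rw [h.cycle b x a] at h₅
  rw [h.swap₁₃ x b a] at h₆
  have : (4 : ℕ) • (a * b * c) = 0 := by grind
  simpa using this

end Nonunital

section Unital

variable {A : Type*} [NonAssocRing A]

lemma associates_of_commute (h : IsAlternativeRing A) [IsAddTorsionFree A] {i z : A}
    (hi : i * i = -1)
    (hz : i * z = z * i) (p : A) :
    associator i p z = 0 := by
  have key (d : A) : associator (i * d) p i + associator (d * i) p i = 0 := by
    rw [h.associator_mul_left_self, h.associator_mul_right_self, h.swap₁₃ d p i, neg_mul, mul_neg,
      ← neg_add, add_comm, ← h.associator_sq, hi]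
    simp [associator]
  have h₀ : associator (i * z) p i = 0 := by
    have := key z
    rw [← hz, ← two_nsmul] at this
    exact (nsmul_eq_zero_iff_right two_ne_zero).mp this
  have h₁ := h.associator_mul_left_self i p (i * z)
  have h₂ : i * (i * z) = -z := by
    rw [← sub_eq_zero.mp (h.left i z), hi]; simp
  rw [h₀, h₂, zero_mul] at h₁
  rw [h.swap₁₃, ← h₁]
  simp [associator, sub_eq_add_neg, add_comm]

lemma conj_commute (h : IsAlternativeRing A) [IsAddTorsionFree A] {i j u : A} (hi : i * i = -1)
    (hij : i * j = -(j * i)) (hu : i * u = u * i) :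
    i * (j * (u * j)) = -(j * (u * i * j)) ∧ j * (u * j) * i = -(j * (u * i * j)) := by
  have hn := h.associates_of_commute hi hu
  have h₁ : associator u i j = 0 := by rw [← h.cycle, hn]
  have h₂ : associator (u * j) i j = 0 := by rw [h.associator_mul_right_self, h₁, mul_zero]
  have h₃ : associator i j (u * j) = 0 := by rw [h.cycle, h₂]
  have h₄ : associator j (u * j) i = 0 := by rw [h.cycle, h₃]
  have h₅ : associator u j i = 0 := by rw [h.swap₂₃, h₁, neg_zero]
  have h₇ : associator i u j = 0 := by rw [h.swap₂₃, hn, neg_zero]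
  have h₆ : associator j i (u * j) = 0 := by rw [h.swap₁₂, h₃, neg_zero]
  constructor
  · rw [← sub_eq_zero.mp h₃, hij, neg_mul, sub_eq_zero.mp h₆, ← sub_eq_zero.mp h₇, hu]
  · rw [sub_eq_zero.mp h₄, sub_eq_zero.mp h₅, show j * i = -(i * j) by rw [hij, neg_neg],
      mul_neg, mul_neg, ← sub_eq_zero.mp h₁]

lemma commute_sub_conj (h : IsAlternativeRing A) [IsAddTorsionFree A] {i j u : A} (hi : i * i = -1)
    (hj : j * j = -1)
    (hij : i * j = -(j * i)) (hu : i * u = u * i) :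
    i * (u - j * (u * j)) = (u - j * (u * j)) * i ∧
      j * (u - j * (u * j)) = (u - j * (u * j)) * j := by
  constructor
  · rw [mul_sub, sub_mul, (h.conj_commute hi hij hu).1, (h.conj_commute hi hij hu).2, hu]
  · rw [mul_sub, sub_mul, ← sub_eq_zero.mp (h.left j (u * j)),
      sub_eq_zero.mp (h.flexible j (u * j)), sub_eq_zero.mp (h.right u j), hj]
    simp [add_comm]

lemma mul_self_mul_eq_neg (h : IsAlternativeRing A) {i u : A} (hi : i * i = -1)
    (hu : i * u = u * i) :
    i * (i * u) = -u ∧ i * u * i = -u := by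
  constructor
  · rw [← sub_eq_zero.mp (h.left i u), hi]; simp
  · rw [hu, sub_eq_zero.mp (h.right u i), hi]; simp

lemma sub_conj_sub_mul_eq (h : IsAlternativeRing A) [IsAddTorsionFree A] {i j u : A}
    (hi : i * i = -1)
    (hij : i * j = -(j * i)) (hu : i * u = u * i) :
    (u - j * (u * j)) - i * (i * u - j * (i * u * j)) = u + u := by
  obtain ⟨h₁, h₂⟩ := h.mul_self_mul_eq_neg hi hu
  rw [mul_sub, (h.conj_commute hi hij (h₁.trans h₂.symm)).1, h₁, h₂]
  simp

lemma mul_add_mul_commute (h : IsAlternativeRing A) {i : A} (hi : i * i = -1) (x : A) :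
    i * (i * x + x * i) = (i * x + x * i) * i := by
  rw [mul_add, add_mul, ← sub_eq_zero.mp (h.left i x), ← sub_eq_zero.mp (h.flexible i x),
    sub_eq_zero.mp (h.right x i), hi]
  simp [add_comm]

end Unital
end IsAlternativeRing

namespace Oct

open scoped Quaternion

@[simp] lemma zero_a : (0 : Oct).a = 0 := rfl
@[simp] lemma zero_b : (0 : Oct).b = 0 := rfl
@[simp] lemma one_a : (1 : Oct).a = 1 := rfl
@[simp] lemma one_b : (1 : Oct).b = 0 := rfl
@[simp] lemma add_a (x y : Oct) : (x + y).a = x.a + y.a := rfl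
@[simp] lemma add_b (x y : Oct) : (x + y).b = x.b + y.b := rfl
@[simp] lemma sub_a (x y : Oct) : (x - y).a = x.a - y.a := rfl
@[simp] lemma sub_b (x y : Oct) : (x - y).b = x.b - y.b := rfl
@[simp] lemma neg_a (x : Oct) : (-x).a = -x.a := rfl
@[simp] lemma neg_b (x : Oct) : (-x).b = -x.b := rfl
@[simp] lemma smul_a (r : ℝ) (x : Oct) : (r • x).a = r • x.a := rfl
@[simp] lemma smul_b (r : ℝ) (x : Oct) : (r • x).b = r • x.b := rfl
@[simp] lemma mul_a (x y : Oct) : (x * y).a = x.a * y.a - star y.b * x.b := rfl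
@[simp] lemma mul_b (x y : Oct) : (x * y).b = y.b * x.a + x.b * star y.a := rfl

instance : NonAssocRing Oct :=
  { (inferInstance : AddCommGroup Oct), (inferInstance : One Oct), (inferInstance : Mul Oct) with
    left_distrib := fun x y z => by ext <;> simp <;> ring
    right_distrib := fun x y z => by ext <;> simp <;> ring
    zero_mul := fun x => by ext <;> simp
    mul_zero := fun x => by ext <;> simp
    one_mul := fun x => by ext <;> simp
    mul_one := fun x => by ext <;> simp }

instance : IsScalarTower ℝ Oct Oct :=
  ⟨fun r x y => by ext <;> simp <;> ring⟩

instance : SMulCommClass ℝ Oct Oct :=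
  ⟨fun r x y => by ext <;> simp <;> ring⟩

/-- The octonion with the given coordinates in the standard basis. -/
def ofCoords (x0 x1 x2 x3 x4 x5 x6 x7 : ℝ) : Oct := ⟨⟨x0, x1, x2, x3⟩, ⟨x4, x5, x6, x7⟩⟩

lemma exists_eq_ofCoords (x : Oct) :
    ∃ x0 x1 x2 x3 x4 x5 x6 x7, x = ofCoords x0 x1 x2 x3 x4 x5 x6 x7 :=
  ⟨x.a.re, x.a.imI, x.a.imJ, x.a.imK, x.b.re, x.b.imI, x.b.imJ, x.b.imK, rfl⟩

lemma mul_eq_ofCoords (x y : Oct) : x * y =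
    ofCoords
      (x.a.re * y.a.re - x.a.imI * y.a.imI - x.a.imJ * y.a.imJ - x.a.imK * y.a.imK
        - x.b.re * y.b.re - x.b.imI * y.b.imI - x.b.imJ * y.b.imJ - x.b.imK * y.b.imK)
      (x.a.re * y.a.imI + x.a.imI * y.a.re + x.a.imJ * y.a.imK - x.a.imK * y.a.imJ
        + x.b.re * y.b.imI - x.b.imI * y.b.re - x.b.imJ * y.b.imK + x.b.imK * y.b.imJ)
      (x.a.re * y.a.imJ - x.a.imI * y.a.imK + x.a.imJ * y.a.re + x.a.imK * y.a.imI
        + x.b.re * y.b.imJ + x.b.imI * y.b.imK - x.b.imJ * y.b.re - x.b.imK * y.b.imI)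
      (x.a.re * y.a.imK + x.a.imI * y.a.imJ - x.a.imJ * y.a.imI + x.a.imK * y.a.re
        + x.b.re * y.b.imK - x.b.imI * y.b.imJ + x.b.imJ * y.b.imI - x.b.imK * y.b.re)
      (x.a.re * y.b.re - x.a.imI * y.b.imI - x.a.imJ * y.b.imJ - x.a.imK * y.b.imK
        + x.b.re * y.a.re + x.b.imI * y.a.imI + x.b.imJ * y.a.imJ + x.b.imK * y.a.imK)
      (x.a.re * y.b.imI + x.a.imI * y.b.re - x.a.imJ * y.b.imK + x.a.imK * y.b.imJ
        - x.b.re * y.a.imI + x.b.imI * y.a.re - x.b.imJ * y.a.imK + x.b.imK * y.a.imJ)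
      (x.a.re * y.b.imJ + x.a.imI * y.b.imK + x.a.imJ * y.b.re - x.a.imK * y.b.imI
        - x.b.re * y.a.imJ + x.b.imI * y.a.imK + x.b.imJ * y.a.re - x.b.imK * y.a.imI)
      (x.a.re * y.b.imK - x.a.imI * y.b.imJ + x.a.imJ * y.b.imI + x.a.imK * y.b.re
        - x.b.re * y.a.imK - x.b.imI * y.a.imJ + x.b.imJ * y.a.imI + x.b.imK * y.a.re) := by
  refine Oct.ext (QuaternionAlgebra.ext ?_ ?_ ?_ ?_) (QuaternionAlgebra.ext ?_ ?_ ?_ ?_) <;>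
    simp [ofCoords] <;> ring

section ofCoords

variable (r x0 x1 x2 x3 x4 x5 x6 x7 y0 y1 y2 y3 y4 y5 y6 y7 : ℝ)

lemma ofCoords_mul : ofCoords x0 x1 x2 x3 x4 x5 x6 x7 * ofCoords y0 y1 y2 y3 y4 y5 y6 y7 =
    ofCoords
      (x0 * y0 - x1 * y1 - x2 * y2 - x3 * y3 - x4 * y4 - x5 * y5 - x6 * y6 - x7 * y7)
      (x0 * y1 + x1 * y0 + x2 * y3 - x3 * y2 + x4 * y5 - x5 * y4 - x6 * y7 + x7 * y6)
      (x0 * y2 - x1 * y3 + x2 * y0 + x3 * y1 + x4 * y6 + x5 * y7 - x6 * y4 - x7 * y5)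
      (x0 * y3 + x1 * y2 - x2 * y1 + x3 * y0 + x4 * y7 - x5 * y6 + x6 * y5 - x7 * y4)
      (x0 * y4 - x1 * y5 - x2 * y6 - x3 * y7 + x4 * y0 + x5 * y1 + x6 * y2 + x7 * y3)
      (x0 * y5 + x1 * y4 - x2 * y7 + x3 * y6 - x4 * y1 + x5 * y0 - x6 * y3 + x7 * y2)
      (x0 * y6 + x1 * y7 + x2 * y4 - x3 * y5 - x4 * y2 + x5 * y3 + x6 * y0 - x7 * y1)
      (x0 * y7 - x1 * y6 + x2 * y5 + x3 * y4 - x4 * y3 - x5 * y2 + x6 * y1 + x7 * y0) :=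
  mul_eq_ofCoords _ _

lemma ofCoords_add : ofCoords x0 x1 x2 x3 x4 x5 x6 x7 + ofCoords y0 y1 y2 y3 y4 y5 y6 y7 =
    ofCoords (x0 + y0) (x1 + y1) (x2 + y2) (x3 + y3) (x4 + y4) (x5 + y5) (x6 + y6) (x7 + y7) :=
  rfl

lemma ofCoords_sub : ofCoords x0 x1 x2 x3 x4 x5 x6 x7 - ofCoords y0 y1 y2 y3 y4 y5 y6 y7 =
    ofCoords (x0 - y0) (x1 - y1) (x2 - y2) (x3 - y3) (x4 - y4) (x5 - y5) (x6 - y6) (x7 - y7) :=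
  rfl

lemma ofCoords_neg : -ofCoords x0 x1 x2 x3 x4 x5 x6 x7 =
    ofCoords (-x0) (-x1) (-x2) (-x3) (-x4) (-x5) (-x6) (-x7) :=
  rfl

lemma smul_ofCoords : r • ofCoords x0 x1 x2 x3 x4 x5 x6 x7 =
    ofCoords (r * x0) (r * x1) (r * x2) (r * x3) (r * x4) (r * x5) (r * x6) (r * x7) :=
  rfl

end ofCoords

lemma zero_eq_ofCoords : (0 : Oct) = ofCoords 0 0 0 0 0 0 0 0 := rfl
lemma one_eq_ofCoords : (1 : Oct) = ofCoords 1 0 0 0 0 0 0 0 := rfl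
lemma e_one_eq_ofCoords : e 1 = ofCoords 0 1 0 0 0 0 0 0 := rfl
lemma e_two_eq_ofCoords : e 2 = ofCoords 0 0 1 0 0 0 0 0 := rfl
lemma e_three_eq_ofCoords : e 3 = ofCoords 0 0 0 1 0 0 0 0 := rfl
lemma e_four_eq_ofCoords : e 4 = ofCoords 0 0 0 0 1 0 0 0 := rfl
lemma e_five_eq_ofCoords : e 5 = ofCoords 0 0 0 0 0 1 0 0 := rfl
lemma e_six_eq_ofCoords : e 6 = ofCoords 0 0 0 0 0 0 1 0 := rfl
lemma e_seven_eq_ofCoords : e 7 = ofCoords 0 0 0 0 0 0 0 1 := rfl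

lemma isAlternativeRing : IsAlternativeRing Oct where
  left x y := by
    obtain ⟨x0, x1, x2, x3, x4, x5, x6, x7, rfl⟩ := exists_eq_ofCoords x
    obtain ⟨y0, y1, y2, y3, y4, y5, y6, y7, rfl⟩ := exists_eq_ofCoords y
    simp only [associator, ofCoords_mul, ofCoords_sub, zero_eq_ofCoords]
    congr 1 <;> ring
  right x y := by
    obtain ⟨x0, x1, x2, x3, x4, x5, x6, x7, rfl⟩ := exists_eq_ofCoords x
    obtain ⟨y0, y1, y2, y3, y4, y5, y6, y7, rfl⟩ := exists_eq_ofCoords y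
    simp only [associator, ofCoords_mul, ofCoords_sub, zero_eq_ofCoords]
    congr 1 <;> ring

/-- A pair of anticommuting imaginary units together with an element generating `𝕆` over the
quaternion subalgebra they span. -/
structure IsBasicTriple (i j l : Oct) : Prop where
  sq_i : i * i = -1
  sq_j : j * j = -1
  sq_ij : i * j * (i * j) = -1
  anticomm : i * j = -(j * i)
  antiassoc : i * j * l = -(i * (j * l))
  span : ∀ p : Oct, ∃ c : Fin 8 → ℝ, p = c 0 • 1 + c 1 • i + c 2 • j + c 3 • (i * j) +
    c 4 • l + c 5 • (i * l) + c 6 • (j * l) + c 7 • (i * j * l)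

lemma isBasicTriple_e_one : IsBasicTriple (e 1) (e 2) (e 4) := by
  refine ⟨?_, ?_, ?_, ?_, ?_, fun p => ⟨![p.a.re, p.a.imI, p.a.imJ, p.a.imK,
      p.b.re, p.b.imI, p.b.imJ, p.b.imK], ?_⟩⟩
  on_goal 6 => obtain ⟨x0, x1, x2, x3, x4, x5, x6, x7, rfl⟩ := exists_eq_ofCoords p
  all_goals
    simp only [e_one_eq_ofCoords, e_two_eq_ofCoords, e_four_eq_ofCoords, one_eq_ofCoords,
      smul_ofCoords, ofCoords_mul, ofCoords_neg, ofCoords_add]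
    congr 1 <;> simp [ofCoords]

lemma isBasicTriple_e_two : IsBasicTriple (e 2) (e 1) (e 4) := by
  refine ⟨?_, ?_, ?_, ?_, ?_, fun p => ⟨![p.a.re, p.a.imJ, p.a.imI, -p.a.imK,
      p.b.re, p.b.imJ, p.b.imI, -p.b.imK], ?_⟩⟩
  on_goal 6 => obtain ⟨x0, x1, x2, x3, x4, x5, x6, x7, rfl⟩ := exists_eq_ofCoords p
  all_goals
    simp only [e_one_eq_ofCoords, e_two_eq_ofCoords, e_four_eq_ofCoords, one_eq_ofCoords,
      smul_ofCoords, ofCoords_mul, ofCoords_neg, ofCoords_add]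
    congr 1 <;> simp [ofCoords]

lemma isBasicTriple_e_three : IsBasicTriple (e 3) (e 1) (e 4) := by
  refine ⟨?_, ?_, ?_, ?_, ?_, fun p => ⟨![p.a.re, p.a.imK, p.a.imI, p.a.imJ,
      p.b.re, p.b.imK, p.b.imI, p.b.imJ], ?_⟩⟩
  on_goal 6 => obtain ⟨x0, x1, x2, x3, x4, x5, x6, x7, rfl⟩ := exists_eq_ofCoords p
  all_goals
    simp only [e_one_eq_ofCoords, e_three_eq_ofCoords, e_four_eq_ofCoords, one_eq_ofCoords,
      smul_ofCoords, ofCoords_mul, ofCoords_neg, ofCoords_add]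
    congr 1 <;> simp [ofCoords]

lemma isBasicTriple_e_four : IsBasicTriple (e 4) (e 1) (e 2) := by
  refine ⟨?_, ?_, ?_, ?_, ?_, fun p => ⟨![p.a.re,
      p.b.re, p.a.imI, -p.b.imI, p.a.imJ, -p.b.imJ, p.a.imK, p.b.imK], ?_⟩⟩
  on_goal 6 => obtain ⟨x0, x1, x2, x3, x4, x5, x6, x7, rfl⟩ := exists_eq_ofCoords p
  all_goals
    simp only [e_one_eq_ofCoords, e_two_eq_ofCoords, e_four_eq_ofCoords, one_eq_ofCoords,
      smul_ofCoords, ofCoords_mul, ofCoords_neg, ofCoords_add]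
    congr 1 <;> simp [ofCoords]

lemma isBasicTriple_e_five : IsBasicTriple (e 5) (e 1) (e 2) := by
  refine ⟨?_, ?_, ?_, ?_, ?_, fun p => ⟨![p.a.re,
      p.b.imI, p.a.imI, p.b.re, p.a.imJ, -p.b.imK, p.a.imK, -p.b.imJ], ?_⟩⟩
  on_goal 6 => obtain ⟨x0, x1, x2, x3, x4, x5, x6, x7, rfl⟩ := exists_eq_ofCoords p
  all_goals
    simp only [e_one_eq_ofCoords, e_two_eq_ofCoords, e_five_eq_ofCoords, one_eq_ofCoords,
      smul_ofCoords, ofCoords_mul, ofCoords_neg, ofCoords_add]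
    congr 1 <;> simp [ofCoords]

lemma isBasicTriple_e_six : IsBasicTriple (e 6) (e 2) (e 1) := by
  refine ⟨?_, ?_, ?_, ?_, ?_, fun p => ⟨![p.a.re,
      p.b.imJ, p.a.imJ, p.b.re, p.a.imI, p.b.imK, -p.a.imK, -p.b.imI], ?_⟩⟩
  on_goal 6 => obtain ⟨x0, x1, x2, x3, x4, x5, x6, x7, rfl⟩ := exists_eq_ofCoords p
  all_goals
    simp only [e_one_eq_ofCoords, e_two_eq_ofCoords, e_six_eq_ofCoords, one_eq_ofCoords,
      smul_ofCoords, ofCoords_mul, ofCoords_neg, ofCoords_add]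
    congr 1 <;> simp [ofCoords]

lemma isBasicTriple_e_seven : IsBasicTriple (e 7) (e 3) (e 1) := by
  refine ⟨?_, ?_, ?_, ?_, ?_, fun p => ⟨![p.a.re,
      p.b.imK, p.a.imK, p.b.re, p.a.imI, -p.b.imJ, p.a.imJ, -p.b.imI], ?_⟩⟩
  on_goal 6 => obtain ⟨x0, x1, x2, x3, x4, x5, x6, x7, rfl⟩ := exists_eq_ofCoords p
  all_goals
    simp only [e_one_eq_ofCoords, e_three_eq_ofCoords, e_seven_eq_ofCoords, one_eq_ofCoords,
      smul_ofCoords, ofCoords_mul, ofCoords_neg, ofCoords_add]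
    congr 1 <;> simp [ofCoords]

lemma exists_isBasicTriple (a : Fin 7) : ∃ j l, IsBasicTriple (e a.succ) j l := by
  fin_cases a
  exacts [⟨_, _, isBasicTriple_e_one⟩, ⟨_, _, isBasicTriple_e_two⟩,
    ⟨_, _, isBasicTriple_e_three⟩, ⟨_, _, isBasicTriple_e_four⟩,
    ⟨_, _, isBasicTriple_e_five⟩, ⟨_, _, isBasicTriple_e_six⟩,
    ⟨_, _, isBasicTriple_e_seven⟩]

lemma e_zero : e 0 = 1 := rfl

/-- The coordinates of an octonion in the standard basis. -/
def coord (p : Oct) : Fin 8 → ℝ :=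
  ![p.a.re, p.a.imI, p.a.imJ, p.a.imK, p.b.re, p.b.imI, p.b.imJ, p.b.imK]

lemma coord_e (m n : Fin 8) : coord (e m) n = if m = n then 1 else 0 := by
  fin_cases m <;> fin_cases n <;> rfl

lemma re_mul_conj (p q : Oct) : re (p * conj q) = ∑ k, coord p k * coord q k := by
  simp [re, conj, coord, Fin.sum_univ_eight]
  ring

lemma re_mul_conj_e (m n : Fin 8) : re (e m * conj (e n)) = if m = n then 1 else 0 := by
  simp [re_mul_conj, coord_e]

lemma mul_eq_neg_mul_sub {p q : Oct} (hp : re p = 0) (hq : re q = 0) :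
    p * q = -(q * p) - (2 * re (p * conj q)) • 1 := by
  obtain ⟨x0, x1, x2, x3, x4, x5, x6, x7, rfl⟩ := exists_eq_ofCoords p
  obtain ⟨y0, y1, y2, y3, y4, y5, y6, y7, rfl⟩ := exists_eq_ofCoords q
  obtain rfl : x0 = 0 := hp
  obtain rfl : y0 = 0 := hq
  simp only [re_mul_conj, one_eq_ofCoords, smul_ofCoords, ofCoords_mul, ofCoords_neg,
    ofCoords_sub, Fin.sum_univ_eight]
  congr 1 <;> simp [ofCoords, coord] <;> ring

lemma re_e_succ (a : Fin 7) : re (e a.succ) = 0 := by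
  fin_cases a <;> rfl

lemma e_succ_anticomm {a b : Fin 7} (hab : a ≠ b) :
    e a.succ * e b.succ = -(e b.succ * e a.succ) := by
  simpa [re_mul_conj_e, hab] using mul_eq_neg_mul_sub (re_e_succ a) (re_e_succ b)

lemma e_succ_mul_self (a : Fin 7) : e a.succ * e a.succ = -1 := by
  have := mul_eq_neg_mul_sub (re_e_succ a) (re_e_succ a)
  simp only [re_mul_conj_e, if_true] at this
  linear_combination (norm := module) (1 / 2 : ℝ) • this

lemma re_mul_mul (p q r : Oct) : re (p * q * r) = re (p * (q * r)) := by
  obtain ⟨x0, x1, x2, x3, x4, x5, x6, x7, rfl⟩ := exists_eq_ofCoords p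
  obtain ⟨y0, y1, y2, y3, y4, y5, y6, y7, rfl⟩ := exists_eq_ofCoords q
  obtain ⟨z0, z1, z2, z3, z4, z5, z6, z7, rfl⟩ := exists_eq_ofCoords r
  simp only [ofCoords_mul]
  simp only [re, ofCoords]
  ring

lemma real_part_formula (p : Oct) :
    (5 / 12 : ℝ) • p - (1 / 12 : ℝ) • ∑ i : Fin 7, e i.succ * p * e i.succ = re p • 1 := by
  obtain ⟨x0, x1, x2, x3, x4, x5, x6, x7, rfl⟩ := exists_eq_ofCoords p
  simp only [Fin.sum_univ_seven]
  change _ - (1 / 12 : ℝ) • (e 1 * _ * e 1 + e 2 * _ * e 2 + e 3 * _ * e 3 + e 4 * _ * e 4 +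
    e 5 * _ * e 5 + e 6 * _ * e 6 + e 7 * _ * e 7) = _
  simp only [e_one_eq_ofCoords, e_two_eq_ofCoords, e_three_eq_ofCoords, e_four_eq_ofCoords,
    e_five_eq_ofCoords, e_six_eq_ofCoords, e_seven_eq_ofCoords,
    one_eq_ofCoords, smul_ofCoords, ofCoords_mul, ofCoords_add, ofCoords_sub]
  congr 1 <;> simp [re, ofCoords] <;> ring

end Oct

namespace IsAlternativeRing

variable {A : Type*} [NonAssocRing A]

lemma associator_eq_zero_of_associates (h : IsAlternativeRing A) {a l z : A}
    (ha : ∀ p, associator a p z = 0) :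
    associator l a z = 0 ∧ associator l (a * l) z = 0 := by
  constructor
  · rw [h.swap₁₂, ha, neg_zero]
  · rw [h.swap₁₂, h.associator_mul_of_associates ha, h.left, zero_mul, neg_zero]

lemma commute_mul (h : IsAlternativeRing A) {a b z : A} (hz : ∀ p q, associator p q z = 0)
    (ha : a * z = z * a)
    (hb : b * z = z * b) : a * b * z = z * (a * b) := by
  have h₁ := sub_eq_zero.mp (hz a b)
  have h₂ : a * z * b = a * (z * b) := sub_eq_zero.mp (by rw [← associator, h.swap₂₃, hz, neg_zero])
  have h₃ : z * a * b = z * (a * b) := sub_eq_zero.mp (by rw [← associator, ← h.cycle, hz])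
  rw [h₁, hb, ← h₂, ha, h₃]

lemma commute_of_antiassoc (h : IsAlternativeRing A) [IsAddTorsionFree A] {i j l z : A}
    (hij : i * j * (i * j) = -1)
    (hl : i * j * l = -(i * (j * l))) (hz : ∀ p q, associator p q z = 0)
    (hi : i * z = z * i) (hj : j * z = z * j) : l * z = z * l := by
  have hn (p q : A) : associator z p q = 0 := by rw [← h.cycle, hz]
  have h₁ : i * j * l * z = z * (i * j * l) := by
    have h₂ : associator i j l = (2 : ℕ) • (i * j * l) := by
      rw [associator, two_nsmul, sub_eq_add_neg, ← hl]
    have h₃ := h.commute_associator hn i j l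
    rw [h₂, mul_smul_comm, smul_mul_assoc] at h₃
    exact (nsmul_right_injective two_ne_zero h₃).symm
  have h₂ : l = -(i * j * (i * j * l)) := by
    rw [← sub_eq_zero.mp (h.left (i * j) l), hij, neg_one_mul, neg_neg]
  rw [h₂, neg_mul, mul_neg, h.commute_mul hz (h.commute_mul hz hi hj) h₁]

end IsAlternativeRing

lemma Oct.IsBasicTriple.linearMap_eq_zero {i j l : Oct} (ht : IsBasicTriple i j l) {W : Type*}
    [AddCommGroup W] [Module ℝ W] (f : Oct →ₗ[ℝ] W) (h₀ : f 1 = 0) (h₁ : f i = 0) (h₂ : f j = 0)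
    (h₃ : f (i * j) = 0) (h₄ : f l = 0) (h₅ : f (i * l) = 0) (h₆ : f (j * l) = 0)
    (h₇ : f (i * j * l) = 0) : f = 0 := by
  ext p
  obtain ⟨c, hc⟩ := ht.span p
  rw [hc]
  simp [h₀, h₁, h₂, h₃, h₄, h₅, h₆, h₇]

/-- The split null extension `𝕆 ⊕ V` of the octonions by a bimodule. -/
def SplitExtension (V : Type*) : Type _ := Oct × V

section SplitExtension

set_option linter.unusedSectionVars false

variable {V : Type*} [NormedAddCommGroup V] [NormedSpace ℝ V] [OctBimodule V]

lemma lmo_mul_sub (p q : Oct) (x : V) :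
    lmo (p * q) x - lmo p (lmo q x) = rmo p (lmo q x) - lmo q (rmo p x) :=
  OctBimodule.assoc_cyc₁ p q x

lemma lmo_mul_sub_right (p q : Oct) (x : V) :
    lmo (p * q) x - lmo p (lmo q x) = rmo q (rmo p x) - rmo (p * q) x :=
  OctBimodule.assoc_cyc₂ p q x

lemma lmo_mul_sub_swap (p q : Oct) (x : V) :
    lmo (p * q) x - lmo p (lmo q x) = -(lmo (q * p) x - lmo q (lmo p x)) :=
  OctBimodule.assoc_alt p q x

@[simp] lemma lmo_one (x : V) : lmo 1 x = x := OctBimodule.lm_one x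
@[simp] lemma rmo_one (x : V) : rmo 1 x = x := OctBimodule.rm_one x
lemma lmo_add (p q : Oct) : (lmo (p + q) : V →L[ℝ] V) = lmo p + lmo q := map_add _ _ _
lemma rmo_add (p q : Oct) : (rmo (p + q) : V →L[ℝ] V) = rmo p + rmo q := map_add _ _ _
lemma lmo_smul (r : ℝ) (p : Oct) : (lmo (r • p) : V →L[ℝ] V) = r • lmo p := map_smul _ _ _
lemma rmo_smul (r : ℝ) (p : Oct) : (rmo (r • p) : V →L[ℝ] V) = r • rmo p := map_smul _ _ _
@[simp] lemma lmo_zero : (lmo 0 : V →L[ℝ] V) = 0 := map_zero _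
@[simp] lemma rmo_zero : (rmo 0 : V →L[ℝ] V) = 0 := map_zero _
lemma lmo_neg (p : Oct) : (lmo (-p) : V →L[ℝ] V) = -lmo p := map_neg _ _
lemma rmo_neg (p : Oct) : (rmo (-p) : V →L[ℝ] V) = -rmo p := map_neg _ _

lemma lmo_mul_self (p : Oct) (x : V) : lmo (p * p) x = lmo p (lmo p x) := by
  have := IsAddTorsionFree.of_isTorsionFree ℝ V
  have := lmo_mul_sub_swap p p x
  rwa [self_eq_neg, sub_eq_zero] at this

lemma rmo_mul_self (p : Oct) (x : V) : rmo (p * p) x = rmo p (rmo p x) := by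
  have := lmo_mul_sub_right p p x
  rw [lmo_mul_self, sub_self] at this
  exact (sub_eq_zero.mp this.symm).symm

namespace SplitExtension

instance : AddCommGroup (SplitExtension V) := inferInstanceAs (AddCommGroup (Oct × V))
instance : Module ℝ (SplitExtension V) := inferInstanceAs (Module ℝ (Oct × V))
instance : One (SplitExtension V) := ⟨((1, 0) : Oct × V)⟩
instance : Mul (SplitExtension V) :=
  ⟨fun x y => ((x.1 * y.1, lmo x.1 y.2 + rmo y.1 x.2) : Oct × V)⟩

@[ext] lemma ext {x y : SplitExtension V} (h₁ : x.1 = y.1) (h₂ : x.2 = y.2) : x = y :=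
  Prod.ext h₁ h₂

@[simp] lemma add_fst (x y : SplitExtension V) : (x + y).1 = x.1 + y.1 := rfl
@[simp] lemma add_snd (x y : SplitExtension V) : (x + y).2 = x.2 + y.2 := rfl
@[simp] lemma sub_fst (x y : SplitExtension V) : (x - y).1 = x.1 - y.1 := rfl
@[simp] lemma sub_snd (x y : SplitExtension V) : (x - y).2 = x.2 - y.2 := rfl
@[simp] lemma zero_fst : (0 : SplitExtension V).1 = 0 := rfl
@[simp] lemma zero_snd : (0 : SplitExtension V).2 = 0 := rfl
@[simp] lemma smul_fst (r : ℝ) (x : SplitExtension V) : (r • x).1 = r • x.1 := rfl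
@[simp] lemma smul_snd (r : ℝ) (x : SplitExtension V) : (r • x).2 = r • x.2 := rfl
@[simp] lemma one_fst : (1 : SplitExtension V).1 = 1 := rfl
@[simp] lemma one_snd : (1 : SplitExtension V).2 = 0 := rfl
@[simp] lemma mul_fst (x y : SplitExtension V) : (x * y).1 = x.1 * y.1 := rfl
@[simp] lemma mul_snd (x y : SplitExtension V) : (x * y).2 = lmo x.1 y.2 + rmo y.1 x.2 := rfl

instance : NonAssocRing (SplitExtension V) :=
  { (inferInstance : AddCommGroup (SplitExtension V)), (inferInstance : One (SplitExtension V)),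
    (inferInstance : Mul (SplitExtension V)) with
    left_distrib := fun x y z => by ext1 <;> simp [mul_add, rmo_add]; abel
    right_distrib := fun x y z => by ext1 <;> simp [add_mul, lmo_add]; abel
    zero_mul := fun x => by ext1 <;> simp
    mul_zero := fun x => by ext1 <;> simp
    one_mul := fun x => by ext1 <;> simp
    mul_one := fun x => by ext1 <;> simp }

instance : IsScalarTower ℝ (SplitExtension V) (SplitExtension V) :=
  ⟨fun r x y => by ext1 <;> simp [lmo_smul, smul_mul_assoc]⟩

instance : SMulCommClass ℝ (SplitExtension V) (SplitExtension V) :=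
  ⟨fun r x y => by ext1 <;> simp [rmo_smul, mul_smul_comm]⟩

instance : IsAddTorsionFree (SplitExtension V) := .of_isTorsionFree ℝ _

lemma isAlternativeRing : IsAlternativeRing (SplitExtension V) where
  left x y := by
    ext1
    · exact Oct.isAlternativeRing.left x.1 y.1
    · have h₁ := lmo_mul_sub x.1 y.1 x.2
      have h₂ := lmo_mul_sub_right x.1 y.1 x.2
      have h₃ := lmo_mul_sub y.1 x.1 x.2
      have h₄ := lmo_mul_sub_swap x.1 y.1 x.2
      simp only [associator, sub_snd, mul_snd, mul_fst, map_add, lmo_mul_self, zero_snd]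
      grind
  right x y := by
    ext1
    · exact Oct.isAlternativeRing.right x.1 y.1
    · have h₃ := lmo_mul_sub y.1 x.1 y.2
      have h₄ := lmo_mul_sub_swap x.1 y.1 y.2
      simp only [associator, sub_snd, mul_snd, mul_fst, map_add, rmo_mul_self, zero_snd]
      grind

variable (V) in
/-- The embedding of the octonions into the split null extension. -/
def inl : Oct →ₗ[ℝ] SplitExtension V := LinearMap.inl ℝ Oct V

/-- The embedding of the bimodule into the split null extension. -/
def inr : V →ₗ[ℝ] SplitExtension V := LinearMap.inr ℝ Oct V

@[simp] lemma inl_fst (p : Oct) : (inl V p).1 = p := rfl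
@[simp] lemma inl_snd (p : Oct) : (inl V p).2 = 0 := rfl
@[simp] lemma inr_fst (x : V) : (inr x).1 = 0 := rfl
@[simp] lemma inr_snd (x : V) : (inr x).2 = x := rfl

lemma inr_injective : Function.Injective (inr : V → SplitExtension V) :=
  fun _ _ h => congrArg Prod.snd h

lemma inl_one : inl V 1 = 1 := rfl
lemma inl_mul (p q : Oct) : inl V (p * q) = inl V p * inl V q := by ext1 <;> simp
lemma inl_mul_inr (p : Oct) (x : V) : inl V p * inr x = inr (lmo p x) := by ext1 <;> simp
lemma inr_mul_inl (x : V) (p : Oct) : inr x * inl V p = inr (rmo p x) := by ext1 <;> simp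

lemma associator_inr_eq_zero {x : V}
    (hx : ∀ p q, associator (inl V p) (inl V q) (inr x) = 0) (a b : SplitExtension V) :
    associator a b (inr x) = 0 := by
  have h := congrArg Prod.snd (hx a.1 b.1)
  ext1
  · simp [associator]
  · simpa [associator] using h

end SplitExtension

open SplitExtension

lemma mem_ReSet_iff {x : V} : x ∈ ReSet V ↔
    (∀ a b, associator a b (inr x) = 0) ∧ ∀ p, inl V p * inr x = inr x * inl V p := by
  constructor
  · intro hx
    refine ⟨associator_inr_eq_zero fun p q => ?_, fun p => ?_⟩
    · rw [associator, ← inl_mul, inl_mul_inr, inl_mul_inr, inl_mul_inr, hx.1, sub_self]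
    · rw [inl_mul_inr, inr_mul_inl, hx.2]
  · intro hx
    refine ⟨fun p q => inr_injective ?_, fun p => inr_injective ?_⟩
    · simpa [associator, sub_eq_zero, ← inl_mul, inl_mul_inr] using hx.1 (inl V p) (inl V q)
    · simpa [inl_mul_inr, inr_mul_inl] using hx.2 p

lemma mem_ReSet_of_commute {i j l : Oct} (ht : IsBasicTriple i j l) {x : V}
    (hi : lmo i x = rmo i x) (hj : lmo j x = rmo j x) : x ∈ ReSet V := by
  have h := SplitExtension.isAlternativeRing (V := V)
  have neg_one : inl V (-1) = -1 := by rw [map_neg, inl_one]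
  have hi' : inl V i * inr x = inr x * inl V i := by rw [inl_mul_inr, inr_mul_inl, hi]
  have hj' : inl V j * inr x = inr x * inl V j := by rw [inl_mul_inr, inr_mul_inl, hj]
  have h₁ := h.associates_of_commute (by rw [← inl_mul, ht.sq_i, neg_one]) hi'
  have h₂ := h.associates_of_commute (by rw [← inl_mul, ht.sq_j, neg_one]) hj'
  have h₃ (p) : associator (inl V (i * j)) p (inr x) = 0 := by
    rw [inl_mul, h.associator_mul_of_associates h₁, h₂, zero_mul]
  have h₄ (q) : associator (inl V l) (inl V q) (inr x) = 0 := by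
    refine LinearMap.congr_fun (ht.linearMap_eq_zero ((LinearMap.mulRight ℝ (inr x) ∘ₗ
      LinearMap.mulLeft ℝ (inl V l) - LinearMap.mulLeft ℝ (inl V l) ∘ₗ
      LinearMap.mulRight ℝ (inr x)) ∘ₗ inl V) ?_ ?_ ?_ ?_ ?_ ?_ ?_ ?_) q
    · change associator (inl V l) (inl V 1) (inr x) = 0
      simp [inl_one, associator]
    · exact (h.associator_eq_zero_of_associates h₁).1
    · exact (h.associator_eq_zero_of_associates h₂).1
    · exact (h.associator_eq_zero_of_associates h₃).1
    · exact h.left _ _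
    all_goals simp only [inl_mul, LinearMap.comp_apply]
    · exact (h.associator_eq_zero_of_associates h₁).2
    · exact (h.associator_eq_zero_of_associates h₂).2
    · simp only [inl_mul] at h₃
      exact (h.associator_eq_zero_of_associates h₃).2
  have h₅ (p q) : associator (inl V p) (inl V q) (inr x) = 0 := by
    refine LinearMap.congr_fun (ht.linearMap_eq_zero ((LinearMap.mulRight ℝ (inr x) ∘ₗ
      LinearMap.mulRight ℝ (inl V q) - LinearMap.mulRight ℝ (inl V q * inr x)) ∘ₗ inl V)
      ?_ (h₁ _) (h₂ _) (h₃ _) (h₄ _) ?_ ?_ ?_) p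
    · change associator (inl V 1) (inl V q) (inr x) = 0
      simp [inl_one, associator]
    all_goals simp only [inl_mul, LinearMap.comp_apply]
    · exact (h.associator_mul_of_associates h₁ _ _).trans (by rw [h₄, zero_mul])
    · exact (h.associator_mul_of_associates h₂ _ _).trans (by rw [h₄, zero_mul])
    · simp only [inl_mul] at h₃
      exact (h.associator_mul_of_associates h₃ _ _).trans (by rw [h₄, zero_mul])
  have hn := associator_inr_eq_zero h₅
  have hl : inl V l * inr x = inr x * inl V l := by
    refine h.commute_of_antiassoc ?_ ?_ hn hi' hj'
    · simp only [← inl_mul, ht.sq_ij, neg_one]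
    · simp only [← inl_mul, ht.antiassoc, map_neg]
  refine mem_ReSet_iff.2 ⟨hn, fun p => sub_eq_zero.1 ?_⟩
  have hc {a b : SplitExtension V} (ha : a * inr x = inr x * a) (hb : b * inr x = inr x * b) :=
    h.commute_mul hn ha hb
  refine LinearMap.congr_fun (ht.linearMap_eq_zero ((LinearMap.mulRight ℝ (inr x) -
      LinearMap.mulLeft ℝ (inr x)) ∘ₗ inl V) ?_ ?_ ?_ ?_ ?_ ?_ ?_ ?_) p <;>
    simp only [LinearMap.comp_apply, LinearMap.sub_apply, LinearMap.mulRight_apply,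
      LinearMap.mulLeft_apply, sub_eq_zero, inl_mul]
  · rw [inl_one, one_mul, mul_one]
  · exact hi'
  · exact hj'
  · exact hc hi' hj'
  · exact hl
  · exact hc hi' hl
  · exact hc hj' hl
  · exact hc (hc hi' hj') hl

end SplitExtension

namespace IsAlternativeRing

variable {A : Type*} [NonAssocRing A]

lemma mul_mul_mul_eq_zero_of_anticommute (h : IsAlternativeRing A) [IsAddTorsionFree A]
    {i j l x : A}
    (hi : i * x = -(x * i)) (hj : j * x = -(x * j)) (hl : l * x = -(x * l))
    (hij : i * j * x = -(x * (i * j))) (hil : i * l * x = -(x * (i * l)))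
    (hjl : j * l * x = -(x * (j * l))) (hijl : i * j * l * x = -(x * (i * j * l)))
    (ail : i * l = -(l * i)) (ajl : j * l = -(l * j)) (aijl : i * j * l = -(l * (i * j)))
    (hanti : i * j * l = -(i * (j * l))) : i * (j * (l * x)) = 0 := by
  have h₁ : i * (j * (l * x)) = i * j * l * x := by
    rw [(h.mul_mul_of_anticommute (h.mul_anticommute hi hl hil ail)
      (h.mul_anticommute hj hl hjl ajl) (h.mul_anticommute hij hl hijl aijl)).1,
      (h.mul_mul_of_anticommute hij hl hijl).1, neg_neg]
  have h₂ : i * (j * (l * x)) = -(i * j * l * x) := by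
    rw [(h.mul_mul_of_anticommute hj hl hjl).1, mul_neg, (h.mul_mul_of_anticommute hi hjl _).1,
      hanti, neg_mul]
    rw [show i * (j * l) = -(i * j * l) by rw [hanti, neg_neg], neg_mul, hijl, mul_neg]
  rw [← h₁] at h₂
  exact self_eq_neg.mp h₂

end IsAlternativeRing

section RealPart

open SplitExtension

variable {V : Type*} [NormedAddCommGroup V] [NormedSpace ℝ V] [OctBimodule V]

variable (V) in
/-- The real part of a bimodule, as a submodule. -/
def reSubmodule : Submodule ℝ V where
  carrier := ReSet V
  zero_mem' := by simp [ReSet]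
  add_mem' := fun hx hy => ⟨fun p q => by simp [hx.1 p q, hy.1 p q],
    fun p => by simp [hx.2 p, hy.2 p]⟩
  smul_mem' := fun r x hx => ⟨fun p q => by simp [hx.1 p q], fun p => by simp [hx.2 p]⟩

lemma rmo_mul_of_mem {v : V} (hv : v ∈ ReSet V) (p q : Oct) :
    rmo (p * q) v = rmo q (rmo p v) := by
  have h := lmo_mul_sub_right p q v
  rw [hv.1, sub_self] at h
  exact (sub_eq_zero.mp h.symm).symm

lemma rmo_lmo_of_mem {v : V} (hv : v ∈ ReSet V) (p q : Oct) :
    rmo q (lmo p v) = lmo (p * q) v := by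
  rw [hv.2, hv.2, rmo_mul_of_mem hv]

lemma lmo_e_succ_lmo_e_succ (a : Fin 7) (x : V) : lmo (e a.succ) (lmo (e a.succ) x) = -x := by
  rw [← lmo_mul_self, e_succ_mul_self, lmo_neg, neg_apply, lmo_one]

lemma inl_e_succ_mul_self (a : Fin 7) : inl V (e a.succ) * inl V (e a.succ) = -1 := by
  rw [← inl_mul, e_succ_mul_self, map_neg, inl_one]

lemma inl_e_succ_anticomm {a b : Fin 7} (hab : a ≠ b) :
    inl V (e a.succ) * inl V (e b.succ) = -(inl V (e b.succ) * inl V (e a.succ)) := by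
  rw [← inl_mul, ← inl_mul, e_succ_anticomm hab, map_neg]

lemma exists_eq_add_lmo_of_commute (a : Fin 7) {x : V}
    (hx : lmo (e a.succ) x = rmo (e a.succ) x) :
    ∃ r' ∈ ReSet V, ∃ r ∈ ReSet V, x = r' + lmo (e a.succ) r := by
  obtain ⟨j, l, ht⟩ := exists_isBasicTriple a
  set i := e a.succ
  have h := SplitExtension.isAlternativeRing (V := V)
  have hi : inl V i * inl V i = -1 := inl_e_succ_mul_self a
  have hj : inl V j * inl V j = -1 := by rw [← inl_mul, ht.sq_j, map_neg, inl_one]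
  have hij : inl V i * inl V j = -(inl V j * inl V i) := by
    rw [← inl_mul, ← inl_mul, ht.anticomm, map_neg]
  have key {y : V} (hy : lmo i y = rmo i y) : y - lmo j (rmo j y) ∈ ReSet V := by
    have hy' : inl V i * inr y = inr y * inl V i := by rw [inl_mul_inr, inr_mul_inl, hy]
    obtain ⟨h₁, h₂⟩ := h.commute_sub_conj hi hj hij hy'
    refine mem_ReSet_of_commute ht (inr_injective ?_) (inr_injective ?_)
    · simpa only [inr_mul_inl, inl_mul_inr, ← map_sub] using h₁
    · simpa only [inr_mul_inl, inl_mul_inr, ← map_sub] using h₂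
  have hx' : inl V i * inr x = inr x * inl V i := by rw [inl_mul_inr, inr_mul_inl, hx]
  have hix : lmo i (lmo i x) = rmo i (lmo i x) := by
    obtain ⟨h₁, h₂⟩ := h.mul_self_mul_eq_neg hi hx'
    refine inr_injective ?_
    rw [← inl_mul_inr, ← inr_mul_inl, ← inl_mul_inr, h₁, h₂]
  have hsum := h.sub_conj_sub_mul_eq hi hij hx'
  simp only [inr_mul_inl, inl_mul_inr, ← map_sub, ← map_add] at hsum
  have hsum := inr_injective hsum
  refine ⟨(1 / 2 : ℝ) • (x - lmo j (rmo j x)), (reSubmodule V).smul_mem _ (key hx),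
    (-(1 / 2) : ℝ) • (lmo i x - lmo j (rmo j (lmo i x))),
    (reSubmodule V).smul_mem _ (key hix), ?_⟩
  rw [map_smul, neg_smul, ← sub_eq_add_neg, ← smul_sub, hsum, ← two_smul ℝ x, smul_smul]
  norm_num

lemma exists_lmo_add_rmo_eq (a : Fin 7) (x : V) :
    ∃ r' ∈ ReSet V, ∃ r ∈ ReSet V,
      lmo (e a.succ) x + rmo (e a.succ) x = r' + lmo (e a.succ) r := by
  refine exists_eq_add_lmo_of_commute a (inr_injective ?_)
  have h := SplitExtension.isAlternativeRing.mul_add_mul_commute (inl_e_succ_mul_self a) (inr x)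
  simpa only [inr_mul_inl, inl_mul_inr, ← map_add] using h

lemma eq_zero_of_anticommute {x : V}
    (hx : ∀ a : Fin 7, lmo (e a.succ) x + rmo (e a.succ) x = 0) : x = 0 := by
  have h := SplitExtension.isAlternativeRing (V := V)
  have hx' (a : Fin 7) : inl V (e a.succ) * inr x = -(inr x * inl V (e a.succ)) := by
    rw [inl_mul_inr, inr_mul_inl, ← map_neg, eq_neg_of_add_eq_zero_left (hx a)]
  have e₁₂ : e 1 * e 2 = e 3 := by
    rw [e_one_eq_ofCoords, e_two_eq_ofCoords, e_three_eq_ofCoords, ofCoords_mul]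
    norm_num
  have e₁₄ : e 1 * e 4 = e 5 := by
    rw [e_one_eq_ofCoords, e_four_eq_ofCoords, e_five_eq_ofCoords, ofCoords_mul]
    norm_num
  have e₂₄ : e 2 * e 4 = e 6 := by
    rw [e_two_eq_ofCoords, e_four_eq_ofCoords, e_six_eq_ofCoords, ofCoords_mul]
    norm_num
  have e₃₄ : e 3 * e 4 = e 7 := by
    rw [e_three_eq_ofCoords, e_four_eq_ofCoords, e_seven_eq_ofCoords, ofCoords_mul]
    norm_num
  have hz := h.mul_mul_mul_eq_zero_of_anticommute (i := inl V (e 1)) (j := inl V (e 2))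
    (l := inl V (e 4)) (x := inr x) (hx' 0) (hx' 1) (hx' 3)
    (by rw [← inl_mul, e₁₂]; exact hx' 2) (by rw [← inl_mul, e₁₄]; exact hx' 4)
    (by rw [← inl_mul, e₂₄]; exact hx' 5) (by rw [← inl_mul, e₁₂, ← inl_mul, e₃₄]; exact hx' 6)
    (inl_e_succ_anticomm (a := 0) (b := 3) (by decide))
    (inl_e_succ_anticomm (a := 1) (b := 3) (by decide))
    (by rw [← inl_mul, e₁₂]; exact inl_e_succ_anticomm (a := 2) (b := 3) (by decide))
    (by simp only [← inl_mul, isBasicTriple_e_one.antiassoc, map_neg])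
  simp only [inl_mul_inr] at hz
  have hz : lmo (e 1) (lmo (e 2) (lmo (e 4) x)) = 0 := inr_injective (hz.trans (map_zero _).symm)
  have cancel (a : Fin 7) {y : V} (hy : lmo (e a.succ) y = 0) : y = 0 := by
    rw [← neg_eq_zero, ← lmo_e_succ_lmo_e_succ a, hy, map_zero]
  exact cancel 3 (cancel 1 (cancel 0 hz))

lemma lmo_add_rmo_lmo_of_mem {v : V} (hv : v ∈ ReSet V) (a b : Fin 7) :
    lmo (e a.succ) (lmo (e b.succ) v) + rmo (e a.succ) (lmo (e b.succ) v) =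
      if a = b then (-2 : ℝ) • v else 0 := by
  rw [rmo_lmo_of_mem hv, ← hv.1]
  split_ifs with hab
  · rw [hab, e_succ_mul_self, lmo_neg, neg_apply, lmo_one, neg_smul, two_smul, neg_add]
  · rw [e_succ_anticomm hab, lmo_neg, neg_apply, neg_add_cancel]

/-- Every element of a bimodule is a combination of real elements. -/
lemma exists_eq_sum_lmo_e (x : V) :
    ∃ v : Fin 8 → V, (∀ m, v m ∈ ReSet V) ∧ x = ∑ m, lmo (e m) (v m) := by
  have h := SplitExtension.isAlternativeRing (V := V)
  choose r' hr' r hr hx using fun a => exists_lmo_add_rmo_eq (V := V) a x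
  set y : V := x + (1 / 2 : ℝ) • ∑ b, lmo (e b.succ) (r' b) - (1 / 2 : ℝ) • r 0 with hy
  have hya (a : Fin 7) : lmo (e a.succ) y + rmo (e a.succ) y = lmo (e a.succ) (r a - r 0) := by
    have h₁ : lmo (e a.succ) y + rmo (e a.succ) y =
        (lmo (e a.succ) x + rmo (e a.succ) x) +
        (1 / 2 : ℝ) • (∑ b, (lmo (e a.succ) (lmo (e b.succ) (r' b)) +
          rmo (e a.succ) (lmo (e b.succ) (r' b)))) -
        (1 / 2 : ℝ) • (lmo (e a.succ) (r 0) + rmo (e a.succ) (r 0)) := by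
      simp only [hy, map_add, map_sub, map_smul, map_sum, Finset.sum_add_distrib, smul_add]
      abel
    rw [h₁, hx, Finset.sum_congr rfl fun b _ => lmo_add_rmo_lmo_of_mem (hr' b) a b,
      Finset.sum_ite_eq, if_pos (Finset.mem_univ _), ← (hr 0).2, map_sub]
    module
  have hra (a : Fin 7) : r a = r 0 := by
    rcases eq_or_ne a 0 with rfl | ha
    · rfl
    have hc : (1 / 2 : ℝ) • (r a - r 0) ∈ ReSet V :=
      (reSubmodule V).smul_mem _ ((reSubmodule V).sub_mem (hr a) (hr 0))
    have hc' := mem_ReSet_iff.1 hc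
    have h₀ := hya 0
    rw [sub_self, map_zero] at h₀
    have key := h.scalar_part_eq_zero (a := inl V (e (0 : Fin 7).succ)) (b := inl V (e a.succ))
      (c := inr ((1 / 2 : ℝ) • (r a - r 0))) (x := inr y) (inl_e_succ_anticomm ha.symm)
      hc'.1 (hc'.2 _)
      (by rw [inl_mul_inr, inr_mul_inl, ← map_neg, eq_neg_of_add_eq_zero_left h₀])
      (by
        rw [inl_mul_inr, inr_mul_inl, inl_mul_inr, ← map_add, ← map_add, hya, map_smul]
        congr 1
        module)
    rw [← inl_mul, inl_mul_inr] at key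
    have key := inr_injective (key.trans (map_zero _).symm)
    have key := congrArg (fun w => lmo (e a.succ) (lmo (e (0 : Fin 7).succ) w)) (hc.1 _ _ ▸ key)
    simp only [lmo_e_succ_lmo_e_succ, map_zero, map_neg, neg_neg] at key
    simpa [sub_eq_zero] using key
  have hy0 : y = 0 := eq_zero_of_anticommute fun a => by rw [hya, hra, sub_self, map_zero]
  refine ⟨Fin.cons ((1 / 2 : ℝ) • r 0) fun b => (-(1 / 2) : ℝ) • r' b, ?_, ?_⟩
  · refine Fin.cases ?_ fun b => ?_
    · exact (reSubmodule V).smul_mem _ (hr 0)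
    · exact (reSubmodule V).smul_mem _ (hr' b)
  · rw [Fin.sum_univ_succ]
    simp only [Fin.cons_zero, Fin.cons_succ, e_zero, lmo_one, map_smul, ← Finset.smul_sum]
    rw [← sub_eq_zero, ← hy0, hy]
    module

/-- Linear maps on a bimodule are determined by their values at the octonionic multiples of real
elements. -/
lemma apply_eq_of_forall_lmo {W F G : Type*} [AddCommMonoid W] [FunLike F V W]
    [AddMonoidHomClass F V W] [FunLike G V W] [AddMonoidHomClass G V W] (f : F) (g : G)
    (hfg : ∀ p, ∀ v ∈ ReSet V, f (lmo p v) = g (lmo p v)) (x : V) : f x = g x := by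
  obtain ⟨v, hv, rfl⟩ := exists_eq_sum_lmo_e x
  simp only [map_sum, hfg _ _ (hv _)]

lemma reO_lmo {v : V} (hv : v ∈ ReSet V) (p : Oct) : reO V (lmo p v) = re p • v := by
  have h := congrArg (fun q => lmo q v) (real_part_formula p)
  simp only [lmo_smul, lmo_one, smul_apply] at h
  rw [← h, reO]
  have hlin (q : Oct) (w : V) : lmo q w = (OctBimodule.lm q : V →L[ℝ] V) w := rfl
  simp only [hlin, map_sub, map_smul, map_sum]
  simp only [← hlin, sub_apply, smul_apply, sum_apply, ContinuousLinearMap.comp_apply,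
    ContinuousLinearMap.id_apply, ← hv.1, rmo_lmo_of_mem hv]

lemma reO_rmo_rmo (p q : Oct) (x : V) : reO V (rmo q (rmo p x)) = reO V (rmo (p * q) x) := by
  refine apply_eq_of_forall_lmo ((reO V).comp ((rmo q).comp (rmo p)))
    ((reO V).comp (rmo (p * q))) (fun r v hv => ?_) x
  simp only [ContinuousLinearMap.comp_apply]
  rw [rmo_lmo_of_mem hv, rmo_lmo_of_mem hv, rmo_lmo_of_mem hv, reO_lmo hv, reO_lmo hv, re_mul_mul]

lemma eq_zero_of_forall_reO_rmo {x : V} (hx : ∀ q, reO V (rmo q x) = 0) : x = 0 := by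
  obtain ⟨v, hv, rfl⟩ := exists_eq_sum_lmo_e x
  refine Finset.sum_eq_zero fun n _ => ?_
  have h := hx (conj (e n))
  simp only [map_sum, rmo_lmo_of_mem (hv _), reO_lmo (hv _), re_mul_conj_e, ite_smul, one_smul,
    zero_smul, Finset.sum_ite_eq', Finset.mem_univ, if_true] at h
  rw [h, map_zero]

lemma IsRightPara.apply_rmo {A : V →L[ℝ] V} (hA : IsRightPara A) {v : V} (hv : v ∈ ReSet V)
    (p : Oct) : A (rmo p v) = rmo p (A v) := by
  have hB (q : Oct) (x : V) : reO V (rmo q (A x)) = reO V (A (rmo q x)) := by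
    simpa [Bop, sub_eq_zero] using hA q x
  refine (sub_eq_zero.1 (eq_zero_of_forall_reO_rmo fun q => ?_)).symm
  rw [map_sub, map_sub, reO_rmo_rmo, hB, hB, rmo_mul_of_mem hv, sub_self]

end RealPart

namespace Oct

lemma norm_conj (p : Oct) : ‖conj p‖ = ‖p‖ := by
  change ‖toLp (conj p)‖ = ‖toLp p‖
  simp [WithLp.prod_norm_eq_of_L2, toLp, conj]

lemma norm_sq_smul_one (p : Oct) : ‖p‖ ^ 2 • (1 : Oct) = p * conj p := by
  have h : ‖p‖ ^ 2 = ‖p.a‖ ^ 2 + ‖p.b‖ ^ 2 := WithLp.prod_norm_sq_eq_of_L2 (toLp p)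
  rw [h]
  ext1
  · simp [conj, sq, ← Quaternion.normSq_eq_norm_mul_self, Quaternion.self_mul_star,
      Quaternion.star_mul_self, add_smul, Algebra.smul_def]
  · simp [conj]

lemma conj_eq_sub (p : Oct) : conj p = (2 * re p) • (1 : Oct) - p := by
  ext1
  · rw [sub_a, smul_a, one_a, ← Quaternion.coe_mul_eq_smul, mul_one]
    exact Quaternion.star_eq_two_re_sub p.a
  · simp [conj]

lemma mul_oinv {s : Oct} (hs : s ≠ 0) : s * oinv s = 1 := by
  rw [oinv, mul_smul_comm, ← norm_sq_smul_one, smul_smul, inv_mul_cancel₀, one_smul]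
  exact pow_ne_zero 2 (norm_ne_zero_iff.2 hs)

lemma norm_oinv (s : Oct) : ‖oinv s‖ = ‖s‖⁻¹ := by
  rw [oinv, norm_smul, norm_conj, norm_inv, norm_pow, norm_norm]
  rcases eq_or_ne ‖s‖ 0 with h | h
  · simp [h]
  · field_simp

lemma oinv_mem_sliceC {J s : Oct} (hs : s ∈ sliceC J) : oinv s ∈ sliceC J := by
  obtain ⟨x, y, hxy⟩ := hs
  refine ⟨(‖s‖ ^ 2)⁻¹ * (2 * re s - x), (‖s‖ ^ 2)⁻¹ * -y, ?_⟩
  rw [oinv, conj_eq_sub]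
  nth_rw 3 [hxy]
  module

lemma sliceC_mul_comm {J p q : Oct} (hp : p ∈ sliceC J) (hq : q ∈ sliceC J) : p * q = q * p := by
  obtain ⟨a, b, rfl⟩ := hp
  obtain ⟨c, d, rfl⟩ := hq
  simp only [add_mul, mul_add, smul_mul_assoc, mul_smul_comm, one_mul, mul_one]
  module

lemma mul_mem_sliceC {J p q : Oct} (hJ : J ∈ unitSphere) (hp : p ∈ sliceC J)
    (hq : q ∈ sliceC J) : p * q ∈ sliceC J := by
  obtain ⟨a, b, rfl⟩ := hp
  obtain ⟨c, d, rfl⟩ := hq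
  refine ⟨a * c - b * d, a * d + b * c, ?_⟩
  have hJ' : J * J = -1 := hJ
  simp only [add_mul, mul_add, smul_mul_assoc, mul_smul_comm, one_mul, mul_one, hJ']
  module

lemma opow_mem_sliceC {J p : Oct} (hJ : J ∈ unitSphere) (hp : p ∈ sliceC J) :
    ∀ n, opow p n ∈ sliceC J
  | 0 => ⟨1, 0, by simp [opow]⟩
  | n + 1 => mul_mem_sliceC hJ hp (opow_mem_sliceC hJ hp n)

lemma self_mem_sliceC (J : Oct) : J ∈ sliceC J := ⟨0, 1, by simp⟩

end Oct

lemma mul_pow_apply_of_comm {V : Type*} [NormedAddCommGroup V] [NormedSpace ℝ V] {S : Set V}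
    {X B : V →L[ℝ] V} (hS : ∀ w ∈ S, B w ∈ S)
    (hX : ∀ k, ∀ w ∈ S, (X ^ k) (B w) = B ((X ^ k) w)) (n : ℕ) :
    ∀ z ∈ S, ((X * B) ^ n) z = (X ^ n) ((B ^ n) z) ∧ ((B * X) ^ n) z = (X ^ n) ((B ^ n) z) := by
  have hB (k : ℕ) (z : V) (hz : z ∈ S) : (B ^ k) z ∈ S := by
    induction k with
    | zero => exact hz
    | succ k ih => rw [pow_succ']; exact hS _ ih
  intro z hz
  induction n with
  | zero => simp
  | succ n ih =>
    have h : B ((X ^ n) ((B ^ n) z)) = (X ^ n) ((B ^ (n + 1)) z) := by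
      rw [← hX n _ (hB n z hz), pow_succ' B, mul_apply_eq_comp]
    have h' : B ((X ^ (n + 1)) ((B ^ n) z)) = (X ^ (n + 1)) ((B ^ (n + 1)) z) := by
      rw [← hX _ _ (hB n z hz), pow_succ' B, mul_apply_eq_comp]
    constructor
    · rw [pow_succ', mul_apply_eq_comp, mul_apply_eq_comp, ih.1, h,
        pow_succ' X, mul_apply_eq_comp]
    · rw [pow_succ', mul_apply_eq_comp, mul_apply_eq_comp, ih.2, ← h',
        pow_succ' X, mul_apply_eq_comp]

section Slice

variable {V : Type*} [NormedAddCommGroup V] [NormedSpace ℝ V] [OctBimodule V] {J : Oct}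

lemma rmo_mul_of_mem_sliceC {p q : Oct} (hp : p ∈ sliceC J) (hq : q ∈ sliceC J) (x : V) :
    rmo (p * q) x = rmo q (rmo p x) := by
  obtain ⟨a, b, rfl⟩ := hp
  obtain ⟨c, d, rfl⟩ := hq
  simp only [add_mul, mul_add, smul_mul_assoc, mul_smul_comm, one_mul, mul_one, rmo_add, rmo_smul,
    add_apply, smul_apply, rmo_one, map_add, map_smul, rmo_mul_self, smul_add]
  module

lemma rmo_opow (hJ : J ∈ unitSphere) {p : Oct} (hp : p ∈ sliceC J) :
    ∀ n, (rmo (opow p n) : V →L[ℝ] V) = rmo p ^ n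
  | 0 => by ext x; simp [opow]
  | n + 1 => by
    ext x
    rw [opow, rmo_mul_of_mem_sliceC hp (opow_mem_sliceC hJ hp n), rmo_opow hJ hp n, pow_succ,
      mul_apply_eq_comp]

lemma mem_CJV_of_mem_ReSet {v : V} (hv : v ∈ ReSet V) : v ∈ CJV V J :=
  ⟨v, hv, 0, (reSubmodule V).zero_mem, by simp⟩

lemma rmo_mem_CJV (hJ : J ∈ unitSphere) {p : Oct} (hp : p ∈ sliceC J) {z : V} (hz : z ∈ CJV V J) :
    rmo p z ∈ CJV V J := by
  obtain ⟨u, hu, w, hw, rfl⟩ := hz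
  obtain ⟨a, b, rfl⟩ := hp
  refine ⟨a • u - b • w, (reSubmodule V).sub_mem ((reSubmodule V).smul_mem a hu)
    ((reSubmodule V).smul_mem b hw), b • u + a • w, (reSubmodule V).add_mem
    ((reSubmodule V).smul_mem b hu) ((reSubmodule V).smul_mem a hw), ?_⟩
  have hJ' : J * J = -1 := hJ
  simp only [rmo_add, rmo_smul, add_apply, smul_apply, rmo_one, map_add, map_smul, hu.2, hw.2,
    ← rmo_mul_self, hJ', rmo_neg, neg_apply]
  module

lemma IsRightPara.apply_rmo_of_mem_CJV {A : V →L[ℝ] V} (hA : IsRightPara A) {p : Oct}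
    (hp : p ∈ sliceC J) {z : V} (hz : z ∈ CJV V J) : A (rmo p z) = rmo p (A z) := by
  obtain ⟨u, hu, w, hw, rfl⟩ := hz
  rw [hw.2, map_add, map_add, map_add, map_add, hA.apply_rmo hu, hA.apply_rmo hw,
    ← rmo_mul_of_mem_sliceC (self_mem_sliceC J) hp, hA.apply_rmo hw,
    rmo_mul_of_mem_sliceC (self_mem_sliceC J) hp]

lemma norm_rmo_le (p : Oct) : ‖(rmo p : V →L[ℝ] V)‖ ≤ ‖p‖ :=
  ContinuousLinearMap.opNorm_le_bound _ (norm_nonneg _) fun x => (OctBimodule.norm_rm p x).le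

variable [CompleteSpace V] {T : V →L[ℝ] V} {s : Oct}

/-- The resolvent of a bounded operator `T` at an octonion `s` in the slice `ℂ_J` with
`‖T‖ < ‖s‖`, expressed through the Neumann series of `T R_{s⁻¹}`. -/
lemma isUnit_and_inverse_rmo_sub (hs : s ∈ sliceC J) (hnorm : ‖T‖ < ‖s‖) :
    ‖T * rmo (oinv s)‖ < 1 ∧ IsUnit ((rmo s : V →L[ℝ] V) - T) ∧
      Ring.inverse ((rmo s : V →L[ℝ] V) - T) =
        rmo (oinv s) * Ring.inverse (1 - T * rmo (oinv s)) := by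
  have hs₀ : 0 < ‖s‖ := (norm_nonneg T).trans_lt hnorm
  have ht := oinv_mem_sliceC hs
  have h₁ : (rmo s * rmo (oinv s) : V →L[ℝ] V) = 1 := by
    ext x
    rw [mul_apply_eq_comp, ← rmo_mul_of_mem_sliceC ht hs, sliceC_mul_comm ht hs,
      mul_oinv (norm_pos_iff.1 hs₀), rmo_one, one_apply_eq_self]
  have h₂ : (rmo (oinv s) * rmo s : V →L[ℝ] V) = 1 := by
    ext x
    rw [mul_apply_eq_comp, ← rmo_mul_of_mem_sliceC hs ht,
      mul_oinv (norm_pos_iff.1 hs₀), rmo_one, one_apply_eq_self]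
  have hlt : ‖T * rmo (oinv s)‖ < 1 := by
    calc ‖T * rmo (oinv s)‖ ≤ ‖T‖ * ‖s‖⁻¹ := (norm_mul_le _ _).trans
          (mul_le_mul_of_nonneg_left ((norm_rmo_le _).trans (norm_oinv s).le) (norm_nonneg _))
      _ < 1 := by rwa [← div_eq_mul_inv, div_lt_one hs₀]
  have hU := isUnit_one_sub_of_norm_lt_one hlt
  let u : (V →L[ℝ] V)ˣ := ⟨rmo s, rmo (oinv s), h₁, h₂⟩
  have hmul : (rmo s : V →L[ℝ] V) - T = (1 - T * rmo (oinv s)) * (u : V →L[ℝ] V) := by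
    simp only [u, sub_mul, one_mul, mul_assoc, h₂, mul_one]
  refine ⟨hlt, hmul ▸ hU.mul u.isUnit, ?_⟩
  rw [hmul, Ring.inverse_mul (Or.inl hU), Ring.inverse_unit]
  rfl

lemma IsPowerAssoc.hasSum_inverse_pow (hpa : IsPowerAssoc T) (hJ : J ∈ unitSphere)
    (hs : s ∈ sliceC J) (hnorm : ‖T‖ < ‖s‖) (k : ℕ) {z : V} (hz : z ∈ CJV V J) :
    HasSum (fun n : ℕ => ((n + k).choose k : ℝ) • (T ^ n) (rmo (opow (oinv s) (k + 1 + n)) z))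
      ((Ring.inverse ((rmo s : V →L[ℝ] V) - T) ^ (k + 1)) z) := by
  obtain ⟨hlt, -, hinv⟩ := isUnit_and_inverse_rmo_sub hs hnorm
  have ht := oinv_mem_sliceC hs
  set B : V →L[ℝ] V := rmo (oinv s)
  set X := Ring.inverse (1 - T * B)
  have hS (w : V) (hw : w ∈ CJV V J) : B w ∈ CJV V J := rmo_mem_CJV hJ ht hw
  have hT (n : ℕ) (w : V) (hw : w ∈ CJV V J) : (T ^ n) (B w) = B ((T ^ n) w) :=
    (hpa n).apply_rmo_of_mem_CJV ht hw
  have hBpow (m : ℕ) {w : V} (hw : w ∈ CJV V J) : (B ^ m) w ∈ CJV V J := by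
    rw [← rmo_opow hJ ht]
    exact rmo_mem_CJV hJ (opow_mem_sliceC hJ ht m) hw
  have hsum (k : ℕ) (w : V) (hw : w ∈ CJV V J) :
      HasSum (fun n : ℕ => ((n + k).choose k : ℝ) • (T ^ n) ((B ^ n) w)) ((X ^ (k + 1)) w) := by
    have h := (hasSum_choose_mul_geometric_of_norm_lt_one' k hlt).mapL
      (ContinuousLinearMap.apply ℝ V w)
    convert h using 2 with n
    · rw [← (mul_pow_apply_of_comm hS hT n w hw).1]
      simp [Nat.cast_smul_eq_nsmul]
    · rfl
  have hX (m : ℕ) (w : V) (hw : w ∈ CJV V J) : (X ^ m) (B w) = B ((X ^ m) w) := by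
    cases m with
    | zero => rfl
    | succ m =>
      refine (hsum m _ (hS w hw)).unique ?_
      convert (hsum m w hw).mapL B using 2 with n
      rw [map_smul, ← hT n _ (hBpow n hw), ← mul_apply_eq_comp (B ^ n), pow_mul_comm',
        mul_apply_eq_comp]
  rw [hinv, (mul_pow_apply_of_comm hS hX (k + 1) z hz).2]
  convert hsum k _ (hBpow (k + 1) hz) using 4 with n
  rw [rmo_opow hJ ht, add_comm, pow_add, mul_apply_eq_comp]

lemma IsPowerAssoc.inverse_pow_rmo (hpa : IsPowerAssoc T) (hJ : J ∈ unitSphere)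
    (hs : s ∈ sliceC J) (hnorm : ‖T‖ < ‖s‖) (k : ℕ) {z : V} (hz : z ∈ CJV V J) {p : Oct}
    (hp : p ∈ sliceC J) : (Ring.inverse ((rmo s : V →L[ℝ] V) - T) ^ (k + 1)) (rmo p z) =
      rmo p ((Ring.inverse ((rmo s : V →L[ℝ] V) - T) ^ (k + 1)) z) := by
  refine (hpa.hasSum_inverse_pow hJ hs hnorm k (rmo_mem_CJV hJ hp hz)).unique ?_
  convert (hpa.hasSum_inverse_pow hJ hs hnorm k hz).mapL (rmo p) using 2 with n
  have ht := opow_mem_sliceC hJ (oinv_mem_sliceC hs) (k + 1 + n)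
  rw [map_smul, ← (hpa n).apply_rmo_of_mem_CJV hp (rmo_mem_CJV hJ ht hz),
    ← rmo_mul_of_mem_sliceC ht hp, sliceC_mul_comm ht hp, rmo_mul_of_mem_sliceC hp ht]

end Slice

/-- Let `V` be a Banach `𝕆`-bimodule, `T` a power-associative bounded right
para-linear operator, `J ∈ 𝕊` and `s ∈ ℂ_J` with `|s| > ‖T‖`.  Then for every `m ≥ 1` and
every `z ∈ ℂ_J(V)`,
`(R_s − T)^{−m}(z) = ∑_{n≥0} C(m+n−1, m−1) Tⁿ(z s^{−m−n})` (norm-convergent series).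
In particular `(R_s − T)^{−1}` is `ℂ_J`-extendable power associative. -/
theorem statement_5 {V : Type*} [NormedAddCommGroup V] [NormedSpace ℝ V] [CompleteSpace V]
    [OctBimodule V] (T : V →L[ℝ] V) (hT : IsRightPara T) (hpa : IsPowerAssoc T)
    (J : Oct) (hJ : J ∈ unitSphere) (s : Oct) (hs : s ∈ sliceC J) (hnorm : ‖T‖ < ‖s‖) :
    IsUnit ((rmo s : V →L[ℝ] V) - T) ∧
    (∀ m : ℕ, 1 ≤ m → ∀ z ∈ CJV V J,
      HasSum
        (fun n : ℕ => ((m + n - 1).choose (m - 1) : ℝ) •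
          (T ^ n) (rmo (Oct.opow (Oct.oinv s) (m + n)) z))
        ((Ring.inverse ((rmo s : V →L[ℝ] V) - T) ^ m) z)) ∧
    CJExtPA J (Ring.inverse ((rmo s : V →L[ℝ] V) - T)) := by
  refine ⟨(isUnit_and_inverse_rmo_sub hs hnorm).2.1, fun m hm z hz => ?_, fun n hn v hv p hp => ?_⟩
  · obtain ⟨k, rfl⟩ := Nat.exists_eq_add_of_le' hm
    convert hpa.hasSum_inverse_pow hJ hs hnorm k hz using 5 with n
    · omega
    · rfl
  · obtain ⟨k, rfl⟩ := Nat.exists_eq_add_of_le' hn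
    exact hpa.inverse_pow_rmo hJ hs hnorm k (mem_CJV_of_mem_ReSet hv) hp
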